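/- For every POMDP Γ, initial belief p₁ ∈ Δ(K), and ε > 0, there exist m₀ ≥ 1, a strategy σ^ε, and a Δ(K)-valued random variable p* measurable with respect to the history before stage m₀, such that: (1) there is an event Ω₀ ⊆ Ω with P^{p₁}_{σ^ε}(Ω₀) ≥ 1 − ε on which ‖p_{m₀} − p*‖₁ ≤ ε; (2) for each realization of p*, there exists a strategy σ such that for all k ∈ Supp(p*), (1/n) Σ_{m=1}^n g_m → γ^k_∞(σ) P^k_σ-almost surely, and γ^{p*}_∞(σ) = v_∞(p*); and (3) E^{p₁}_{σ^ε}[v_∞(p*)] ≥ v_∞(p₁) − ε. -/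

import Mathlib

open MeasureTheory Filter

namespace PomdpPaper

/-- A belief (probability vector) on `Fin n`. -/
def IsBelief {n : ℕ} (p : Fin n → ℝ) : Prop :=
  (∀ k, 0 ≤ p k) ∧ ∑ k, p k = 1

/-- The measure on a finite type associated with a probability vector. -/
noncomputable def vecMeasure {α : Type*} [Fintype α] [MeasurableSpace α] (p : α → ℝ) :
    Measure α :=
  ∑ x : α, ENNReal.ofReal (p x) • Measure.dirac x

/-- The Dirac belief at a point. -/
def diracBelief {n : ℕ} (k : Fin n) : Fin n → ℝ := fun k' => if k' = k then 1 else 0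

/-- The `i`-th binary digit of a real number `x ∈ [0,1)` (as a real number `0` or `1`). -/
noncomputable def digitR (x : ℝ) (i : ℕ) : ℝ :=
  if ⌊x * 2 ^ (i + 1)⌋ % 2 = 1 then 1 else 0

/-- From one uniform seed `x ∈ [0,1)`, a sequence `unif x 0, unif x 1, …` of
(independent, uniformly distributed on `[0,1]`) real numbers, obtained by splitting the
binary digits of `x` along the pairing function. -/
noncomputable def unif (x : ℝ) (m : ℕ) : ℝ :=
  ∑' j : ℕ, digitR x (Nat.pair m j) / 2 ^ (j + 1)

open Classical in
/-- Inverse-transform sampling from a probability vector on `Fin n` using a seed `u ∈ [0,1]`. -/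
noncomputable def sampleFin {n : ℕ} (hn : 0 < n) (p : Fin n → ℝ) (u : ℝ) : Fin n :=
  let s : Finset (Fin n) :=
    Finset.univ.filter fun y : Fin n => u < ∑ z ∈ Finset.univ.filter fun z : Fin n => z ≤ y, p z
  if hs : s.Nonempty then s.min' hs else ⟨0, hn⟩

/-- Inverse-transform sampling from a probability vector on a finite nonempty type. -/
noncomputable def sampleOn {β : Type*} [Fintype β] [Nonempty β] (p : β → ℝ) (u : ℝ) : β :=
  (Fintype.equivFin β).symm
    (sampleFin Fintype.card_pos (fun i => p ((Fintype.equivFin β).symm i)) u)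

/-- A POMDP with states `Fin nK`, actions `Fin nA`, signals `Fin nS`, transition function `q`
and reward function `g` with values in `[0,1]`. -/
structure POMDP where
  nK : ℕ
  nA : ℕ
  nS : ℕ
  hK : 0 < nK
  hA : 0 < nA
  hS : 0 < nS
  q : Fin nK → Fin nA → Fin nK × Fin nS → ℝ
  q_nonneg : ∀ k a y, 0 ≤ q k a y
  q_sum : ∀ k a, ∑ y, q k a y = 1
  g : Fin nK → Fin nA → ℝ
  g_nonneg : ∀ k a, 0 ≤ g k a
  g_le_one : ∀ k a, g k a ≤ 1

namespace POMDP

variable (Γ : POMDP)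

/-- The state space. -/
abbrev K := Fin Γ.nK
/-- The action space. -/
abbrev A := Fin Γ.nA
/-- The signal space. -/
abbrev S := Fin Γ.nS

instance : Nonempty Γ.K := ⟨⟨0, Γ.hK⟩⟩
instance : Nonempty Γ.A := ⟨⟨0, Γ.hA⟩⟩
instance : Nonempty Γ.S := ⟨⟨0, Γ.hS⟩⟩

/-- A history: the finite sequence of past actions and signals. -/
abbrev Hist := List (Γ.A × Γ.S)

/-- A (pure) strategy: a map from histories to actions. -/
abbrev Strategy := Γ.Hist → Γ.A

/-- The sample space carrying all the randomness: an initial state together with a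
uniform seed in `[0,1)` used to draw all the transitions. -/
abbrev Env := Γ.K × ℝ

/-- The probability measure on the sample space induced by the initial belief `p1`:
the initial state is drawn according to `p1`, the seed uniformly on `[0,1)`. -/
noncomputable def envMeasure (p1 : Γ.K → ℝ) : Measure Γ.Env :=
  (vecMeasure p1).prod (volume.restrict (Set.Ico (0 : ℝ) 1))

/-- The trajectory: `(Γ.traj σ ω m).1` is the state `k_{m+1}` at stage `m+1` and
`(Γ.traj σ ω m).2` is the history before stage `m+1` (of length `m`), when the
decision-maker uses strategy `σ` and the randomness is `ω`.  At each stage, the pair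
(new state, signal) is drawn from `q` via inverse-transform sampling from a fresh
uniform variable. -/
noncomputable def traj (σ : Γ.Strategy) (ω : Γ.Env) : ℕ → Γ.K × Γ.Hist
  | 0 => (ω.1, [])
  | m + 1 =>
    let p := traj σ ω m
    let a := σ p.2
    let y := sampleOn (Γ.q p.1 a) (unif ω.2 m)
    (y.1, p.2 ++ [(a, y.2)])

/-- The state `k_{m+1}` at stage `m+1` (`m` is 0-indexed). -/
noncomputable def state (σ : Γ.Strategy) (ω : Γ.Env) (m : ℕ) : Γ.K := (Γ.traj σ ω m).1

/-- The history before stage `m+1` (a list of length `m`). -/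
noncomputable def hist (σ : Γ.Strategy) (ω : Γ.Env) (m : ℕ) : Γ.Hist := (Γ.traj σ ω m).2

/-- The action `a_{m+1}` played at stage `m+1`. -/
noncomputable def act (σ : Γ.Strategy) (ω : Γ.Env) (m : ℕ) : Γ.A := σ (Γ.hist σ ω m)

/-- The reward `g_{m+1}` obtained at stage `m+1`. -/
noncomputable def rew (σ : Γ.Strategy) (ω : Γ.Env) (m : ℕ) : ℝ :=
  Γ.g (Γ.state σ ω m) (Γ.act σ ω m)

/-- The average reward over the first `n` stages. -/
noncomputable def avg (σ : Γ.Strategy) (ω : Γ.Env) (n : ℕ) : ℝ :=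
  (1 / n : ℝ) * ∑ m ∈ Finset.range n, Γ.rew σ ω m

/-- The probability of an event under initial belief `p1` (the strategy `σ` is recorded for
readability; the underlying measure does not depend on it). -/
noncomputable def prob (p1 : Γ.K → ℝ) (_σ : Γ.Strategy) (E : Set Γ.Env) : ℝ :=
  (Γ.envMeasure p1 E).toReal

/-- The long-run average payoff `γ^{p1}_∞(σ) = E[liminf (1/n) ∑ g_m]`. -/
noncomputable def pay (p1 : Γ.K → ℝ) (σ : Γ.Strategy) : ℝ :=
  ∫ ω, atTop.liminf (Γ.avg σ ω) ∂(Γ.envMeasure p1)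

/-- The payoff starting from a deterministic state `k`, i.e. `γ^k_∞(σ)`. -/
noncomputable def payK (k : Γ.K) (σ : Γ.Strategy) : ℝ := Γ.pay (diracBelief k) σ

/-- The value `v_∞(p1)`. -/
noncomputable def val (p1 : Γ.K → ℝ) : ℝ := ⨆ σ : Γ.Strategy, Γ.pay p1 σ

/-- A strategy has finite memory if it is implemented by a finite-state transducer. -/
def FiniteMemory (σ : Γ.Strategy) : Prop :=
  ∃ (n : ℕ) (m0 : Fin n) (σa : Fin n → Γ.A) (σu : Fin n → Γ.A × Γ.S → Fin n),
    ∀ h : Γ.Hist, σ h = σa (h.foldl σu m0)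

/-- A blind MDP: the signal set is a singleton. -/
def Blind : Prop := Γ.nS = 1

/-- The strategy induced by a sequence of actions `a_1, a_2, …` (`as m` is the action played
at stage `m+1`, regardless of the observed history). -/
def blindStrat (as : ℕ → Γ.A) : Γ.Strategy := fun h => as h.length

end POMDP

/-- A sequence is eventually periodic if it is periodic with some period `T ≥ 1` from
some stage `N` on. -/
def EventuallyPeriodic {α : Type*} (as : ℕ → α) : Prop :=
  ∃ T ≥ 1, ∃ N ≥ 1, ∀ m ≥ N, as (m + T) = as m


namespace POMDP

variable (Γ : POMDP)

/-- `Γ.histProb p1 σ h` is the probability, under initial belief `p1` and strategy `σ`,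
that the history before stage `h.length + 1` equals `h`. -/
noncomputable def histProb (p1 : Γ.K → ℝ) (σ : Γ.Strategy) (h : Γ.Hist) : ℝ :=
  Γ.prob p1 σ {ω | Γ.hist σ ω h.length = h}

/-- The belief at stage `h.length + 1` given the history `h`:
`p_m(k) = P(k_m = k | h_m = h)` (defined via Bayes rule, i.e. as a quotient). -/
noncomputable def belief (p1 : Γ.K → ℝ) (σ : Γ.Strategy) (h : Γ.Hist) : Γ.K → ℝ :=
  fun k =>
    Γ.prob p1 σ {ω | Γ.hist σ ω h.length = h ∧ Γ.state σ ω h.length = k} /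
      Γ.histProb p1 σ h

end POMDP

section

/-- Birkhoff average. -/
noncomputable def bav {Ω : Type*} (T : Ω → Ω) (f : Ω → ℝ) (x : Ω) (n : ℕ) : ℝ :=
  (1 / n : ℝ) * ∑ m ∈ Finset.range n, f (T^[m] x)

section
variable {Ω : Type*} {T : Ω → Ω} {f : Ω → ℝ}

lemma bav_nonneg (h0 : ∀ x, 0 ≤ f x) (x : Ω) (n : ℕ) : 0 ≤ bav T f x n := by
  unfold bav
  have : 0 ≤ ∑ m ∈ Finset.range n, f (T^[m] x) := Finset.sum_nonneg fun _ _ => h0 _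
  positivity

lemma bav_le_one (h1 : ∀ x, f x ≤ 1) (x : Ω) (n : ℕ) : bav T f x n ≤ 1 := by
  unfold bav
  rcases Nat.eq_zero_or_pos n with rfl | hn
  · simp
  have : ∑ m ∈ Finset.range n, f (T^[m] x) ≤ n := by
    calc _ ≤ ∑ m ∈ Finset.range n, (1 : ℝ) := Finset.sum_le_sum fun _ _ => h1 _
      _ = n := by simp
  have hn' : (0 : ℝ) < n := by exact_mod_cast hn
  rw [one_div, inv_mul_le_iff₀ hn']; simpa using this

lemma bdd_above {u : ℕ → ℝ} (h : ∀ n, u n ≤ 1) : IsBoundedUnder (· ≤ ·) atTop u :=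
  ⟨1, by simp [h]⟩
lemma bdd_below {u : ℕ → ℝ} (h : ∀ n, 0 ≤ u n) : IsBoundedUnder (· ≥ ·) atTop u :=
  ⟨0, by simp [h]⟩

lemma limsup_le_of_close {u v : ℕ → ℝ} (hu0 : ∀ n, 0 ≤ u n)
    (hv1 : ∀ n, v n ≤ 1)
    (h : Tendsto (fun n => u n - v n) atTop (nhds 0)) : limsup u atTop ≤ limsup v atTop := by
  refine le_of_forall_pos_le_add fun ε hε => ?_
  apply limsup_le_of_le (bdd_below hu0).isCoboundedUnder_le
  have h1 : ∀ᶠ n in atTop, v n < limsup v atTop + ε / 2 :=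
    eventually_lt_of_limsup_lt (by linarith) (bdd_above hv1)
  have h2 : ∀ᶠ n in atTop, u n - v n < ε / 2 := h.eventually_lt_const (by linarith)
  filter_upwards [h1, h2] with n a b
  linarith

lemma liminf_le_of_close {u v : ℕ → ℝ} (hu0 : ∀ n, 0 ≤ u n)
    (hv1 : ∀ n, v n ≤ 1)
    (h : Tendsto (fun n => u n - v n) atTop (nhds 0)) : liminf u atTop ≤ liminf v atTop := by
  refine le_of_forall_pos_le_add fun ε hε => ?_
  suffices liminf u atTop - ε ≤ liminf v atTop by linarith
  apply le_liminf_of_le (bdd_above hv1).isCoboundedUnder_ge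
  have h1 : ∀ᶠ n in atTop, liminf u atTop - ε / 2 < u n :=
    eventually_lt_of_lt_liminf (by linarith) (bdd_below hu0)
  have h2 : ∀ᶠ n in atTop, u n - v n < ε / 2 := h.eventually_lt_const (by linarith)
  filter_upwards [h1, h2] with n a b
  linarith

lemma bav_shift_tendsto (h0 : ∀ x, 0 ≤ f x) (h1 : ∀ x, f x ≤ 1) (x : Ω) :
    Tendsto (fun n => bav T f (T x) n - bav T f x n) atTop (nhds 0) := by
  have key : ∀ n, bav T f (T x) n - bav T f x n = (f (T^[n] x) - f x) / n := by
    intro n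
    have : ∑ m ∈ Finset.range n, f (T^[m] (T x)) =
        ∑ m ∈ Finset.range n, f (T^[m] x) + f (T^[n] x) - f x := by
      have h := Finset.sum_range_succ (fun m => f (T^[m] x)) n
      rw [Finset.sum_range_succ'] at h
      simp only [Function.iterate_succ, Function.comp, Function.iterate_zero, id] at h
      linarith
    unfold bav
    rw [this]; ring
  simp_rw [key]
  apply squeeze_zero_norm (a := fun n : ℕ => (1 : ℝ) / n)
  · intro n
    rw [norm_div]
    simp only [Real.norm_eq_abs, Nat.abs_cast]
    gcongr
    rw [abs_le]; constructor <;> linarith [h0 x, h1 x, h0 (T^[n] x), h1 (T^[n] x)]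
  · exact tendsto_one_div_atTop_nhds_zero_nat

lemma limsup_bav_inv (h0 : ∀ x, 0 ≤ f x) (h1 : ∀ x, f x ≤ 1) (x : Ω) :
    limsup (bav T f (T x)) atTop = limsup (bav T f x) atTop := by
  have h := bav_shift_tendsto (T := T) h0 h1 x
  apply le_antisymm
  · exact limsup_le_of_close (bav_nonneg h0 _) (bav_le_one h1 _) h
  · exact limsup_le_of_close (bav_nonneg h0 _) (bav_le_one h1 _) (by simpa using h.neg)

lemma liminf_bav_inv (h0 : ∀ x, 0 ≤ f x) (h1 : ∀ x, f x ≤ 1) (x : Ω) :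
    liminf (bav T f (T x)) atTop = liminf (bav T f x) atTop := by
  have h := bav_shift_tendsto (T := T) h0 h1 x
  apply le_antisymm
  · exact liminf_le_of_close (bav_nonneg h0 _) (bav_le_one h1 _) h
  · exact liminf_le_of_close (bav_nonneg h0 _) (bav_le_one h1 _) (by simpa using h.neg)

lemma limsup_mem {u : ℕ → ℝ} (h0 : ∀ n, 0 ≤ u n) (h1 : ∀ n, u n ≤ 1) :
    0 ≤ limsup u atTop ∧ limsup u atTop ≤ 1 := by
  constructor
  · apply le_limsup_of_frequently_le (Frequently.of_forall h0) (bdd_above h1)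
  · apply limsup_le_of_le (bdd_below h0).isCoboundedUnder_le (Eventually.of_forall h1)

lemma liminf_mem {u : ℕ → ℝ} (h0 : ∀ n, 0 ≤ u n) (h1 : ∀ n, u n ≤ 1) :
    0 ≤ liminf u atTop ∧ liminf u atTop ≤ 1 := by
  constructor
  · apply le_liminf_of_le (bdd_above h1).isCoboundedUnder_ge (Eventually.of_forall h0)
  · apply liminf_le_of_frequently_le (Frequently.of_forall h1) (bdd_below h0)

variable [MeasurableSpace Ω]

lemma measurable_bav (hT : Measurable T) (hf : Measurable f) (n : ℕ) :
    Measurable (fun x => bav T f x n) := by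
  unfold bav
  exact (Finset.measurable_sum _ fun m _ => hf.comp (hT.iterate m)).const_mul _

lemma integrable_of_mem01 {μ : Measure Ω} [IsFiniteMeasure μ] {F : Ω → ℝ} (hF : Measurable F)
    (h0 : ∀ x, 0 ≤ F x) (h1 : ∀ x, F x ≤ 1) : Integrable F μ :=
  Integrable.of_bound hF.aestronglyMeasurable 1 (ae_of_all _ fun x => by
    rw [Real.norm_eq_abs, abs_of_nonneg (h0 x)]; exact h1 x)

lemma birk_half {μ : Measure Ω} [IsProbabilityMeasure μ] (hT : MeasurePreserving T μ μ)
    (hf : Measurable f) (h0 : ∀ x, 0 ≤ f x) (h1 : ∀ x, f x ≤ 1) :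
    ∫ x, limsup (bav T f x) atTop ∂μ ≤ ∫ x, f x ∂μ := by
  set L : Ω → ℝ := fun x => limsup (bav T f x) atTop with hL
  have hLm : Measurable L := Measurable.limsup (fun n => measurable_bav hT.measurable hf n)
  have hLinv : ∀ x, L (T x) = L x := limsup_bav_inv h0 h1
  have hLn : ∀ n x, L (T^[n] x) = L x := by
    intro n; induction n with
    | zero => intro x; rfl
    | succ n ih => intro x; rw [Function.iterate_succ_apply, ih, hLinv]
  have hL01 : ∀ x, 0 ≤ L x ∧ L x ≤ 1 := fun x => limsup_mem (bav_nonneg h0 x) (bav_le_one h1 x)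
  have hLi : Integrable L μ := integrable_of_mem01 hLm (fun x => (hL01 x).1) (fun x => (hL01 x).2)
  have hfi : Integrable f μ := integrable_of_mem01 hf h0 h1
  suffices H : ∀ ε > 0, ∫ x, L x ∂μ ≤ ∫ x, f x ∂μ + 2 * ε by
    refine le_of_forall_pos_le_add fun ε hε => ?_
    have := H (ε / 2) (by linarith); linarith
  intro ε hε
  let B : ℕ → Set Ω := fun N => {x | ∀ n ∈ Finset.Icc 1 N,
    ∑ i ∈ Finset.range n, f (T^[i] x) < n * (L x - ε)}
  have hBm : ∀ N, MeasurableSet (B N) := by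
    intro N
    have : B N = ⋂ n ∈ Finset.Icc 1 N, {x | ∑ i ∈ Finset.range n, f (T^[i] x) < n * (L x - ε)} := by
      ext x; simp [B]
    rw [this]
    refine Finset.measurableSet_biInter _ fun n _ => ?_
    exact measurableSet_lt (Finset.measurable_sum _ fun m _ => hf.comp (hT.measurable.iterate m))
      ((hLm.sub_const _).const_mul _)
  have hBanti : Antitone B := by
    intro N M h x hx n hn
    apply hx n
    simp only [Finset.mem_Icc] at hn ⊢; omega
  have hBempty : ⋂ N, B N = ∅ := by
    rw [Set.eq_empty_iff_forall_notMem]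
    intro x hx
    rw [Set.mem_iInter] at hx
    have hfr : ∃ᶠ n in atTop, L x - ε < bav T f x n :=
      frequently_lt_of_lt_limsup (bdd_below (bav_nonneg h0 x)).isCoboundedUnder_le
        (by simp only [hL]; linarith)
    obtain ⟨n, hn, hlt⟩ := (hfr.and_eventually (eventually_ge_atTop 1)).exists.imp
      (fun n h => And.intro h.2 h.1)
    have := hx n n (by simp; omega)
    have hn' : (0 : ℝ) < n := by exact_mod_cast hn
    unfold bav at hlt
    rw [one_div, inv_mul_eq_div, lt_div_iff₀ hn'] at hlt
    linarith
  have hlim := tendsto_measure_iInter_atTop (μ := μ) (s := B)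
    (fun N => (hBm N).nullMeasurableSet) hBanti ⟨0, measure_ne_top _ _⟩
  rw [hBempty, measure_empty] at hlim
  obtain ⟨N, hN⟩ := (hlim.eventually_lt_const
    (show (0 : ENNReal) < ENNReal.ofReal ε by simpa using hε)).exists
  have hNr : μ.real (B N) ≤ ε := by
    rw [Measure.real]; exact ENNReal.toReal_le_of_le_ofReal hε.le hN.le
  let f' : Ω → ℝ := fun x => f x + (B N).indicator (fun _ => (1 : ℝ)) x
  have hff' : ∀ x, f x ≤ f' x := fun x => by
    simp only [f']; linarith [Set.indicator_nonneg (s := B N) (f := fun _ => (1 : ℝ))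
      (fun _ _ => zero_le_one) x]
  have hf'0 : ∀ x, 0 ≤ f' x := fun x => (h0 x).trans (hff' x)
  have step : ∀ x, ∃ n, 1 ≤ n ∧ n ≤ N + 1 ∧
      (n : ℝ) * (L x - ε) ≤ ∑ i ∈ Finset.range n, f' (T^[i] x) := by
    intro x
    by_cases hx : x ∈ B N
    · refine ⟨1, le_rfl, by omega, ?_⟩
      have : (1 : ℝ) ≤ f' x := by simp [f', hx, h0 x]
      simp only [Nat.cast_one, one_mul, Finset.range_one, Finset.sum_singleton,
        Function.iterate_zero, id]
      linarith [(hL01 x).2]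
    · simp only [B, Set.mem_ofPred_eq, not_forall, not_lt, Finset.mem_Icc] at hx
      obtain ⟨n, hn, h⟩ := hx
      exact ⟨n, hn.1, by omega, h.trans (Finset.sum_le_sum fun _ _ => hff' _)⟩
  have main : ∀ (M : ℕ) x, (M : ℝ) * (L x - ε) - (N + 1 : ℕ) ≤ ∑ i ∈ Finset.range M, f' (T^[i] x) := by
    intro M
    induction M using Nat.strong_induction_on with
    | _ M ih =>
      intro x
      by_cases hM : M ≤ N + 1
      · have h1 : (M : ℝ) * (L x - ε) ≤ M * 1 := by
          gcongr; linarith [(hL01 x).2]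
        have h2 : (M : ℝ) ≤ (N + 1 : ℕ) := by exact_mod_cast hM
        have h3 : 0 ≤ ∑ i ∈ Finset.range M, f' (T^[i] x) := Finset.sum_nonneg fun _ _ => hf'0 _
        linarith
      · obtain ⟨n, hn1, hn2, hn⟩ := step x
        have e := ih (M - n) (by omega) (T^[n] x)
        rw [hLn] at e
        have hs : ∑ i ∈ Finset.range M, f' (T^[i] x) = ∑ i ∈ Finset.range n, f' (T^[i] x) +
            ∑ i ∈ Finset.range (M - n), f' (T^[i] (T^[n] x)) := by
          conv_lhs => rw [show M = n + (M - n) by omega]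
          rw [Finset.sum_range_add]
          congr 1
          refine Finset.sum_congr rfl fun i _ => ?_
          rw [← Function.iterate_add_apply, add_comm]
        have hc : ((M - n : ℕ) : ℝ) = M - n := by
          rw [Nat.cast_sub (by omega)]
        rw [hs]; rw [hc] at e
        linarith
  have hii : Integrable ((B N).indicator (fun _ => (1 : ℝ))) μ :=
    (integrable_const 1).indicator (hBm N)
  have hf'i : Integrable f' μ := hfi.add hii
  have hf'int : ∫ x, f' x ∂μ = ∫ x, f x ∂μ + μ.real (B N) := by
    simp only [f']
    rw [integral_add hfi hii, integral_indicator_const _ (hBm N)]; simp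
  have hint : ∀ M : ℕ, (M : ℝ) * (∫ x, L x ∂μ - ε) - (N + 1 : ℕ) ≤ M * ∫ x, f' x ∂μ := by
    intro M
    have hTi : ∀ i, Integrable (fun x => f' (T^[i] x)) μ := fun i =>
      (hT.iterate i).integrable_comp_of_integrable hf'i
    have e := integral_mono (μ := μ) (((hLi.sub (integrable_const ε)).const_mul (M : ℝ)).sub
      (integrable_const ((N + 1 : ℕ) : ℝ)))
      (integrable_finsetSum (Finset.range M) fun i _ => hTi i) (main M)
    rw [integral_finsetSum _ fun i _ => hTi i] at e
    have e2 : ∀ i, ∫ x, f' (T^[i] x) ∂μ = ∫ x, f' x ∂μ := by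
      intro i
      have := (hT.iterate i).map_eq
      conv_rhs => rw [← this]
      rw [integral_map (hT.iterate i).measurable.aemeasurable]
      rw [this]; exact hf'i.aestronglyMeasurable
    simp only [e2, Finset.sum_const, Finset.card_range, nsmul_eq_mul] at e
    refine le_trans (le_of_eq ?_) e
    simp only [Pi.sub_apply]
    rw [integral_sub, integral_const_mul, integral_sub hLi (integrable_const _)]
    · simp
    · exact (hLi.sub (integrable_const ε)).const_mul (M : ℝ)
    · exact integrable_const _
  by_contra hcon
  push Not at hcon
  set d := ∫ x, L x ∂μ - ε - ∫ x, f' x ∂μ with hd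
  have hdpos : 0 < d := by rw [hd, hf'int]; linarith
  obtain ⟨M, hM⟩ := exists_nat_gt (((N + 1 : ℕ) : ℝ) / d)
  rw [div_lt_iff₀ hdpos] at hM
  have := hint M
  rw [hd] at hM
  linarith

theorem birkhoff {μ : Measure Ω} [IsProbabilityMeasure μ] (hT : MeasurePreserving T μ μ)
    (hf : Measurable f) (h0 : ∀ x, 0 ≤ f x) (h1 : ∀ x, f x ≤ 1) :
    (∀ᵐ x ∂μ, Tendsto (bav T f x) atTop (nhds (liminf (bav T f x) atTop))) ∧
    ∫ x, liminf (bav T f x) atTop ∂μ = ∫ x, f x ∂μ := by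
  have hub := birk_half hT hf h0 h1
  have hlb := birk_half (f := fun x => 1 - f x) hT (hf.const_sub 1)
    (fun x => by linarith [h1 x]) (fun x => by linarith [h0 x])
  have hfi : Integrable f μ := integrable_of_mem01 hf h0 h1
  set l : Ω → ℝ := fun x => liminf (bav T f x) atTop with hl
  set L : Ω → ℝ := fun x => limsup (bav T f x) atTop with hL
  have hl01 : ∀ x, 0 ≤ l x ∧ l x ≤ 1 := fun x => liminf_mem (bav_nonneg h0 x) (bav_le_one h1 x)
  have hL01 : ∀ x, 0 ≤ L x ∧ L x ≤ 1 := fun x => limsup_mem (bav_nonneg h0 x) (bav_le_one h1 x)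
  have hlm : Measurable l := Measurable.liminf (fun n => measurable_bav hT.measurable hf n)
  have hLm : Measurable L := Measurable.limsup (fun n => measurable_bav hT.measurable hf n)
  have hli : Integrable l μ := integrable_of_mem01 hlm (fun x => (hl01 x).1) (fun x => (hl01 x).2)
  have hLi : Integrable L μ := integrable_of_mem01 hLm (fun x => (hL01 x).1) (fun x => (hL01 x).2)
  have hle : ∀ x, 1 - l x ≤ limsup (bav T (fun x => 1 - f x) x) atTop := by
    intro x
    refine le_of_forall_pos_le_add fun ε hε => ?_
    have hf1 : ∃ᶠ n in atTop, bav T f x n < l x + ε :=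
      frequently_lt_of_liminf_lt (bdd_above (bav_le_one h1 x)).isCoboundedUnder_ge
        (by simp only [hl]; linarith)
    suffices 1 - l x - ε ≤ limsup (bav T (fun x => 1 - f x) x) atTop by linarith
    apply le_limsup_of_frequently_le _ (bdd_above (bav_le_one (fun x => by linarith [h0 x]) x))
    refine (hf1.and_eventually (eventually_ge_atTop 1)).mono ?_
    rintro n ⟨h, hn⟩
    have hn' : (0 : ℝ) < n := by exact_mod_cast hn
    have : bav T (fun x => 1 - f x) x n = 1 - bav T f x n := by
      unfold bav
      rw [Finset.sum_sub_distrib]; simp; field_simp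
    linarith
  have hlb2 : ∫ x, f x ∂μ ≤ ∫ x, l x ∂μ := by
    have e : ∫ x, (1 - l x) ∂μ ≤ ∫ x, limsup (bav T (fun x => 1 - f x) x) atTop ∂μ := by
      apply integral_mono ((integrable_const 1).sub hli) _ hle
      apply integrable_of_mem01
      · exact Measurable.limsup (fun n => measurable_bav hT.measurable (hf.const_sub 1) n)
      · exact fun x => (limsup_mem (bav_nonneg (fun x => by linarith [h1 x]) x)
          (bav_le_one (fun x => by linarith [h0 x]) x)).1
      · exact fun x => (limsup_mem (bav_nonneg (fun x => by linarith [h1 x]) x)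
          (bav_le_one (fun x => by linarith [h0 x]) x)).2
    have e2 := e.trans hlb
    rw [integral_sub (integrable_const 1) hli, integral_sub (integrable_const 1) hfi] at e2
    simp at e2; linarith
  have hlL : ∀ x, l x ≤ L x := fun x =>
    liminf_le_limsup (bdd_above (bav_le_one h1 x)) (bdd_below (bav_nonneg h0 x))
  have hmono : ∫ x, l x ∂μ ≤ ∫ x, L x ∂μ := integral_mono hli hLi hlL
  have hz : ∫ x, (L x - l x) ∂μ = 0 := by
    rw [integral_sub hLi hli]; linarith
  replace hz := (integral_eq_zero_iff_of_nonneg (fun x => sub_nonneg.2 (hlL x)) (hLi.sub hli)).1 hz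
  refine ⟨?_, by linarith⟩
  filter_upwards [hz] with x hx
  have hx' : L x = l x := by simpa [sub_eq_zero] using hx
  exact tendsto_of_liminf_eq_limsup rfl hx' (bdd_above (bav_le_one h1 x))
    (bdd_below (bav_nonneg h0 x))
end

end

section

/-- Lebesgue measure on `[0,1)`. -/
noncomputable def lam : Measure ℝ := volume.restrict (Set.Ico (0 : ℝ) 1)

instance : IsProbabilityMeasure lam := ⟨by simp [lam]⟩

lemma measurable_digitR (i : ℕ) : Measurable (fun x => digitR x i) := by
  unfold digitR
  refine Measurable.ite ?_ measurable_const measurable_const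
  have : Measurable (fun x : ℝ => ⌊x * 2 ^ (i + 1)⌋ % 2) :=
    (measurable_of_countable (fun z : ℤ => z % 2)).comp
      (Int.measurable_floor.comp (measurable_id.mul_const _))
  exact this (measurableSet_singleton 1)

lemma digitR_fract (x : ℝ) (i : ℕ) : digitR (Int.fract (2 * x)) i = digitR x (i + 1) := by
  unfold digitR
  have : Int.fract (2 * x) * 2 ^ (i + 1) = x * 2 ^ (i + 1 + 1) - ((⌊2 * x⌋ * 2 ^ (i + 1) : ℤ) : ℝ) := by
    rw [Int.fract]; push_cast; ring
  rw [this, Int.floor_sub_intCast]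
  have h2 : (⌊x * 2 ^ (i + 1 + 1)⌋ - ⌊2 * x⌋ * 2 ^ (i + 1)) % 2 = ⌊x * 2 ^ (i + 1 + 1)⌋ % 2 := by
    have : ⌊2 * x⌋ * 2 ^ (i + 1) = 2 * (⌊2 * x⌋ * 2 ^ i) := by ring
    rw [this]; omega
  rw [h2]

lemma lam_box (s t : Set ℝ) (ht : MeasurableSet t) :
    lam {x | digitR x 0 ∈ s ∧ Int.fract (2 * x) ∈ t} =
      (s.indicator (fun _ => ENNReal.ofReal (1 / 2)) 0 + s.indicator (fun _ => ENNReal.ofReal (1 / 2)) 1) * lam t := by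
  have hset : ∀ A : Set ℝ, lam A = volume (A ∩ Set.Ico 0 1) := fun A =>
    Measure.restrict_apply' measurableSet_Ico
  have hA : lam {x | digitR x 0 ∈ s ∧ Int.fract (2 * x) ∈ t} =
      volume ({x | (0 : ℝ) ∈ s ∧ 2 * x ∈ t ∩ Set.Ico 0 1} ∪
        {x | (1 : ℝ) ∈ s ∧ 2 * (x + (-1 / 2)) ∈ t ∩ Set.Ico 0 1}) := by
    rw [hset]; congr 1
    ext x
    simp only [Set.mem_inter_iff, Set.mem_ofPred_eq, Set.mem_Ico, Set.mem_union]
    by_cases hx : 0 ≤ x ∧ x < 1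
    · rcases lt_or_ge x (1 / 2) with h | h
      · have hf : ⌊2 * x⌋ = 0 := by rw [Int.floor_eq_iff]; constructor <;> push_cast <;> linarith
        have hd : digitR x 0 = 0 := by simp [digitR, mul_comm x, hf]
        have hfr : Int.fract (2 * x) = 2 * x := by rw [Int.fract, hf]; simp
        rw [hd, hfr]
        constructor
        · rintro ⟨⟨a, b⟩, c, d⟩; left; exact ⟨a, b, by linarith, by linarith⟩
        · rintro (⟨a, b, c, d⟩ | ⟨a, b, c, d⟩)
          · exact ⟨⟨a, b⟩, hx⟩
          · linarith
      · have hf : ⌊2 * x⌋ = 1 := by rw [Int.floor_eq_iff]; constructor <;> push_cast <;> linarith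
        have hd : digitR x 0 = 1 := by simp [digitR, mul_comm x, hf]
        have hfr : Int.fract (2 * x) = 2 * (x + (-1 / 2)) := by rw [Int.fract, hf]; push_cast; ring
        rw [hd, hfr]
        constructor
        · rintro ⟨⟨a, b⟩, c, d⟩; right; exact ⟨a, b, by linarith, by linarith⟩
        · rintro (⟨a, b, c, d⟩ | ⟨a, b, c, d⟩)
          · linarith
          · exact ⟨⟨a, b⟩, hx⟩
    · constructor
      · rintro ⟨_, h⟩; exact absurd h hx
      · rintro (⟨a, b, c, d⟩ | ⟨a, b, c, d⟩)
        · exact absurd ⟨by linarith, by linarith⟩ hx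
        · exact absurd ⟨by linarith, by linarith⟩ hx
  have hm : MeasurableSet (t ∩ Set.Ico 0 1) := ht.inter measurableSet_Ico
  have v1 : volume ((fun x : ℝ => 2 * x) ⁻¹' (t ∩ Set.Ico 0 1)) = ENNReal.ofReal (1 / 2) * lam t := by
    rw [Real.volume_preimage_mul_left two_ne_zero, hset]; norm_num
  have v2 : volume ((fun x : ℝ => 2 * (x + (-1 / 2))) ⁻¹' (t ∩ Set.Ico 0 1)) =
      ENNReal.ofReal (1 / 2) * lam t := by
    rw [← v1]
    exact measure_preimage_add_right volume (-1 / 2 : ℝ) ((fun x : ℝ => 2 * x) ⁻¹' (t ∩ Set.Ico 0 1))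
  have m2 : MeasurableSet {x : ℝ | (1 : ℝ) ∈ s ∧ 2 * (x + (-1 / 2)) ∈ t ∩ Set.Ico 0 1} := by
    refine (MeasurableSet.const _).inter ?_
    exact (show Measurable fun x : ℝ => 2 * (x + (-1 / 2)) by fun_prop) hm
  rw [hA, measure_union _ m2, add_mul]
  · congr 1
    · by_cases h : (0 : ℝ) ∈ s
      · simp only [h, true_and, Set.indicator_of_mem]; exact v1
      · simp [h]
    · by_cases h : (1 : ℝ) ∈ s
      · simp only [h, true_and, Set.indicator_of_mem]; exact v2
      · simp [h]
  · rw [Set.disjoint_left]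
    rintro x ⟨_, _, a, b⟩ ⟨_, _, c, d⟩
    linarith

/-- The law of a single digit. -/
noncomputable def dlaw : Measure ℝ := lam.map (fun x => digitR x 0)
instance : IsProbabilityMeasure dlaw :=
  Measure.isProbabilityMeasure_map (measurable_digitR 0).aemeasurable

lemma lam_box' (s t : Set ℝ) (hs : MeasurableSet s) (ht : MeasurableSet t) :
    lam {x | digitR x 0 ∈ s ∧ Int.fract (2 * x) ∈ t} = dlaw s * lam t := by
  rw [lam_box s t ht]
  congr 1
  have := lam_box s Set.univ MeasurableSet.univ
  rw [measure_univ, mul_one] at this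
  rw [← this, dlaw, Measure.map_apply (measurable_digitR 0) hs]
  simp; rfl

lemma lam_prefix (n : ℕ) : ∀ t : ℕ → Set ℝ, (∀ i, MeasurableSet (t i)) →
    lam {x | ∀ i < n, digitR x i ∈ t i} = ∏ i ∈ Finset.range n, dlaw (t i) := by
  induction n with
  | zero => intro t _; simp
  | succ n ih =>
    intro t ht
    rw [Finset.prod_range_succ', ← ih (fun i => t (i + 1)) (fun i => ht _), mul_comm, ← lam_box' _ _ (ht 0)]
    · congr 1; ext x
      simp only [Set.mem_ofPred_eq, digitR_fract]
      constructor
      · intro h; exact ⟨h 0 (by omega), fun i hi => h (i + 1) (by omega)⟩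
      · rintro ⟨h0, h⟩ i hi
        cases i with
        | zero => exact h0
        | succ i => exact h i (by omega)
    · have : {x : ℝ | ∀ i < n, digitR x i ∈ t (i + 1)} =
          ⋂ i ∈ Finset.range n, (fun x => digitR x i) ⁻¹' (t (i + 1)) := by
        ext x; simp
      rw [this]
      exact Finset.measurableSet_biInter _ fun i _ => measurable_digitR i (ht _)

lemma digits_law : lam.map (fun x i => digitR x i) = Measure.infinitePi (fun _ : ℕ => dlaw) := by
  apply Measure.eq_infinitePi
  intro s t ht
  have hm : Measurable (fun (x : ℝ) (i : ℕ) => digitR x i) :=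
    measurable_pi_lambda _ fun i => measurable_digitR i
  rw [Measure.map_apply hm (.pi s.countable_toSet fun _ _ => ht _)]
  classical
  obtain ⟨n, hn⟩ : ∃ n, s ⊆ Finset.range n := s.exists_nat_subset_range
  have := lam_prefix n (fun i => if i ∈ s then t i else Set.univ)
    (fun i => by split_ifs; exacts [ht i, MeasurableSet.univ])
  have e1 : ∏ i ∈ Finset.range n, dlaw (if i ∈ s then t i else Set.univ) = ∏ i ∈ s, dlaw (t i) := by
    rw [← Finset.prod_subset hn]
    · exact Finset.prod_congr rfl fun i hi => by simp [hi]
    · intro i _ hi; simp [hi]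
  rw [← e1, ← this]
  congr 1; ext x
  simp only [Set.mem_preimage, Set.mem_pi, Set.mem_ofPred_eq]
  constructor
  · intro h i _; split_ifs with hi
    · exact h i hi
    · trivial
  · intro h i hi
    have := h i (Finset.mem_range.1 (hn hi))
    simpa [Finset.mem_coe.1 hi] using this

/-- Sum of (clamped) digits. -/
noncomputable def dsum (b : ℕ → ℝ) : ℝ := ∑' j, (max 0 (min 1 (b j))) / 2 ^ (j + 1)

lemma measurable_dsum : Measurable dsum := by
  have hs : ∀ b : ℕ → ℝ, Summable fun j => (max 0 (min 1 (b j))) / (2 : ℝ) ^ (j + 1) := by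
    intro b
    refine Summable.of_nonneg_of_le (fun j => by positivity) (fun j => ?_)
      (summable_geometric_two' 1)
    rw [div_div, ← pow_succ']
    gcongr
    exact max_le zero_le_one (min_le_left _ _)
  refine measurable_of_tendsto_metrizable (f := fun n b => ∑ j ∈ Finset.range n,
    (max 0 (min 1 (b j))) / (2 : ℝ) ^ (j + 1)) (fun n => ?_) ?_
  · fun_prop
  · rw [tendsto_pi_nhds]; intro b; exact (hs b).hasSum.tendsto_sum_nat

lemma unif_eq (x : ℝ) (m : ℕ) : unif x m = dsum (fun j => digitR x (Nat.pair m j)) := by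
  unfold unif dsum
  congr 1; ext j
  congr 1
  rcases (show digitR x (Nat.pair m j) = 1 ∨ digitR x (Nat.pair m j) = 0 by
    unfold digitR; split_ifs <;> simp) with h | h <;> simp [h]

/-- The law of one uniform. -/
noncomputable def rho : Measure ℝ := (Measure.infinitePi (fun _ : ℕ => dlaw)).map dsum
instance : IsProbabilityMeasure rho := Measure.isProbabilityMeasure_map measurable_dsum.aemeasurable

/-- The law of the noise sequence. -/
noncomputable def noise : Measure (ℕ → ℝ) := Measure.infinitePi (fun _ : ℕ => rho)
instance : IsProbabilityMeasure noise := by unfold noise; infer_instance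

lemma measurable_unif : Measurable unif := by
  refine measurable_pi_lambda _ fun m => ?_
  simp_rw [unif_eq]
  exact measurable_dsum.comp (measurable_pi_lambda _ fun j => measurable_digitR _)

lemma map_unif : lam.map unif = noise := by
  have h1 := Measure.infinitePi_map_piCongrLeft (X := fun _ : ℕ × ℕ => ℝ) (fun _ => dlaw) Nat.pairEquiv.symm
  have h2 := Measure.infinitePi_map_curry (fun (_ _ : ℕ) => dlaw)
  have h3 := Measure.infinitePi_map_pi (μ := fun _ : ℕ => Measure.infinitePi (fun _ : ℕ => dlaw))
    (f := fun _ => dsum) (fun _ => measurable_dsum)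
  have hD : Measurable (fun (x : ℝ) (i : ℕ) => digitR x i) :=
    measurable_pi_lambda _ fun i => measurable_digitR i
  have hS : Measurable (fun (x : ℕ → ℕ → ℝ) (i : ℕ) => dsum (x i)) :=
    measurable_pi_lambda _ fun m => measurable_dsum.comp (measurable_pi_apply m)
  unfold noise rho
  rw [← h3, ← h2, ← h1, ← digits_law]
  rw [Measure.map_map (by fun_prop) hD, Measure.map_map hS (by fun_prop)]
  rw [Measure.map_map (hS.comp (by fun_prop)) ((by fun_prop : Measurable _).comp hD)]
  · congr 1
    ext x m
    rw [unif_eq]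
    simp only [Function.comp]
    congr 1
    ext j
    rw [MeasurableEquiv.coe_piCongrLeft]
    have h := Equiv.piCongrLeft_apply_apply (fun _ : ℕ × ℕ => ℝ) Nat.pairEquiv.symm
      (fun i => digitR x i) (Nat.pair m j)
    rw [← h]
    simp

/-- prepend -/
def consSeq (p : ℝ × (ℕ → ℝ)) : ℕ → ℝ := fun n => Nat.casesOn n p.1 p.2

lemma measurable_consSeq : Measurable consSeq := by
  refine measurable_pi_lambda _ fun n => ?_
  cases n with
  | zero => exact measurable_fst
  | succ n => exact (measurable_pi_apply n).comp measurable_snd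

lemma map_consSeq : (rho.prod noise).map consSeq = noise := by
  apply Measure.eq_infinitePi
  intro s t ht
  rw [Measure.map_apply measurable_consSeq (.pi s.countable_toSet fun _ _ => ht _)]
  classical
  let t' : ℕ → Set ℝ := fun i => if i ∈ s then t i else Set.univ
  have ht' : ∀ i, MeasurableSet (t' i) := fun i => by
    simp only [t']; split_ifs; exacts [ht i, MeasurableSet.univ]
  obtain ⟨n, hn⟩ : ∃ n, s ⊆ Finset.range n := s.exists_nat_subset_range
  have e1 : ∏ i ∈ Finset.range (n + 1), rho (t' i) = ∏ i ∈ s, rho (t i) := by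
    rw [← Finset.prod_subset (hn.trans (Finset.range_mono (Nat.le_succ n)))]
    · exact Finset.prod_congr rfl fun i hi => by simp [t', hi]
    · intro i _ hi; simp [t', hi]
  rw [← e1, Finset.prod_range_succ', mul_comm]
  have e2 := Measure.infinitePi_pi (fun _ : ℕ => rho) (s := Finset.range n) (t := fun i => t' (i + 1))
    (fun i _ => ht' _)
  rw [← e2]
  change _ = _ * noise _
  rw [← Measure.prod_prod]
  congr 1; ext ⟨a, u⟩
  simp only [Set.mem_preimage, Set.mem_pi, Set.mem_prod, Finset.coe_range, Set.mem_Iio]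
  constructor
  · intro h
    constructor
    · simp only [t']; split_ifs with hi
      · exact h 0 hi
      · trivial
    · intro i _; simp only [t']; split_ifs with hi
      · exact h (i + 1) hi
      · trivial
  · rintro ⟨h0, h⟩ i hi
    cases i with
    | zero => simpa [t', Finset.mem_coe.1 hi, consSeq] using h0
    | succ i =>
      have := h i (by have := Finset.mem_range.1 (hn hi); omega)
      simpa [t', Finset.mem_coe.1 hi, consSeq] using this

/-- The shift on sequences. -/
def shiftSeq (u : ℕ → ℝ) : ℕ → ℝ := fun n => u (n + 1)
lemma measurable_shiftSeq : Measurable shiftSeq :=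
  measurable_pi_lambda _ fun n => measurable_pi_apply (n + 1)

lemma map_uncons : noise.map (fun u => (u 0, shiftSeq u)) = rho.prod noise := by
  conv_lhs => rw [← map_consSeq]
  rw [Measure.map_map ((measurable_pi_apply 0).prodMk measurable_shiftSeq) measurable_consSeq]
  exact Measure.map_id

end

section

lemma measurable_sampleFin {n : ℕ} (hn : 0 < n) (p : Fin n → ℝ) : Measurable (sampleFin hn p) := by
  classical
  let G : (Fin n → Prop) → Fin n := fun P =>
    let s : Finset (Fin n) := Finset.univ.filter P
    if hs : s.Nonempty then s.min' hs else ⟨0, hn⟩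
  have hG : Measurable G := measurable_of_countable G
  have : sampleFin hn p = fun u => G (fun y => u < ∑ z ∈ Finset.univ.filter fun z : Fin n => z ≤ y, p z) := by
    funext u
    simp only [sampleFin, G]
  rw [this]
  refine hG.comp (measurable_pi_lambda _ fun y => ?_)
  exact (measurableSet_lt measurable_id measurable_const).mem

lemma measurable_sampleOn {a b : ℕ} [Nonempty (Fin a × Fin b)] (p : Fin a × Fin b → ℝ) :
    Measurable (sampleOn p) := by
  unfold sampleOn
  exact (measurable_of_countable _).comp (measurable_sampleFin _ _)

namespace POMDP
variable (Γ : POMDP)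

/-- One step of the (state, continuation strategy) chain. -/
noncomputable def step (z : Γ.K × Γ.Strategy) (r : ℝ) : Γ.K × Γ.Strategy :=
  ((sampleOn (Γ.q z.1 (z.2 [])) r).1,
    fun h => z.2 ((z.2 [], (sampleOn (Γ.q z.1 (z.2 [])) r).2) :: h))

/-- The skew product. -/
noncomputable def th (w : (Γ.K × Γ.Strategy) × (ℕ → ℝ)) : (Γ.K × Γ.Strategy) × (ℕ → ℝ) :=
  (Γ.step w.1 (w.2 0), shiftSeq w.2)

/-- The reward function. -/
noncomputable def gf (z : Γ.K × Γ.Strategy) : ℝ := Γ.g z.1 (z.2 [])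

/-- The reward function on the skew product. -/
noncomputable def gw (w : (Γ.K × Γ.Strategy) × (ℕ → ℝ)) : ℝ := Γ.gf w.1

lemma measurable_step_aux {K A S H : Type} [MeasurableSpace K] [MeasurableSpace A] [MeasurableSpace S]
    [Countable K] [Countable A] [Countable S] [MeasurableSingletonClass K] [MeasurableSingletonClass A]
    [MeasurableSingletonClass S]
    (Y : K × A → ℝ → K × S) (hY : ∀ x, Measurable (Y x)) (h0 : H) (c : A × S → H → H) :
    Measurable (fun w : (K × (H → A)) × ℝ => ((Y (w.1.1, w.1.2 h0) w.2).1,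
      fun h => w.1.2 (c (w.1.2 h0, (Y (w.1.1, w.1.2 h0) w.2).2) h))) := by
  have h1 : Measurable (fun x : (K × A) × ℝ => Y x.1 x.2) :=
    measurable_from_prod_countable_right hY
  have h0' : Measurable (fun w : (K × (H → A)) × ℝ => w.1.2 h0) := by fun_prop
  have hy : Measurable (fun w : (K × (H → A)) × ℝ => Y (w.1.1, w.1.2 h0) w.2) :=
    h1.comp (((measurable_fst.comp measurable_fst).prodMk h0').prodMk measurable_snd)
  refine hy.fst.prodMk (measurable_pi_lambda _ fun h => ?_)
  have h2 : Measurable (fun x : (A × S) × (H → A) => x.2 (c x.1 h)) :=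
    measurable_from_prod_countable_right fun x => measurable_pi_apply (c x h)
  exact h2.comp ((h0'.prodMk hy.snd).prodMk (measurable_snd.comp measurable_fst))

lemma continuous_step_aux {K A S H : Type} [TopologicalSpace K] [TopologicalSpace A]
    [TopologicalSpace S] [DiscreteTopology K] [DiscreteTopology A] [DiscreteTopology S]
    (Y : K × A → K × S) (h0 : H) (c : A × S → H → H) :
    Continuous (fun w : (K × (H → A)) => ((Y (w.1, w.2 h0)).1,
      fun h => w.2 (c (w.2 h0, (Y (w.1, w.2 h0)).2) h))) := by
  have h0' : Continuous (fun w : K × (H → A) => w.2 h0) := by fun_prop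
  have hy : Continuous (fun w : K × (H → A) => Y (w.1, w.2 h0)) :=
    (continuous_of_discreteTopology (f := Y)).comp (continuous_fst.prodMk h0')
  refine hy.fst.prodMk (continuous_pi fun h => ?_)
  have h2 : Continuous (fun x : (A × S) × (H → A) => x.2 (c x.1 h)) :=
    continuous_prod_of_discrete_left.2 fun x => continuous_apply (c x h)
  exact h2.comp ((h0'.prodMk hy.snd).prodMk continuous_snd)

lemma measurable_step : Measurable (fun w : (Γ.K × Γ.Strategy) × ℝ => Γ.step w.1 w.2) :=
  measurable_step_aux (fun x r => sampleOn (Γ.q x.1 x.2) r) (fun x => measurable_sampleOn (Γ.q x.1 x.2))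
    [] List.cons

lemma continuous_step (r : ℝ) : Continuous (fun z => Γ.step z r) :=
  continuous_step_aux (fun x : Γ.K × Γ.A => sampleOn (Γ.q x.1 x.2) r) [] List.cons

lemma measurable_th : Measurable Γ.th :=
  (Γ.measurable_step.comp (measurable_fst.prodMk
    ((measurable_pi_apply 0).comp measurable_snd))).prodMk (measurable_shiftSeq.comp measurable_snd)

lemma continuous_gf : Continuous Γ.gf :=
  (continuous_of_discreteTopology (f := fun x : Γ.K × Γ.A => Γ.g x.1 x.2)).comp
      (f := fun z : Γ.K × Γ.Strategy => (z.1, z.2 [])) (by fun_prop)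

lemma measurable_gf : Measurable Γ.gf := Γ.continuous_gf.measurable

lemma measurable_gw : Measurable Γ.gw := Γ.measurable_gf.comp measurable_fst

lemma gw_nonneg (w) : 0 ≤ Γ.gw w := Γ.g_nonneg _ _
lemma gw_le_one (w) : Γ.gw w ≤ 1 := Γ.g_le_one _ _

/-- Initial point of the skew product. -/
noncomputable def ini (σ : Γ.Strategy) (ω : Γ.Env) : (Γ.K × Γ.Strategy) × (ℕ → ℝ) :=
  ((ω.1, σ), unif ω.2)

/-- Continuation strategy. -/
def cont (σ : Γ.Strategy) (h : Γ.Hist) : Γ.Strategy := fun h' => σ (h ++ h')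

lemma th_iter (σ : Γ.Strategy) (ω : Γ.Env) (m : ℕ) :
    Γ.th^[m] (Γ.ini σ ω) =
      ((Γ.state σ ω m, Γ.cont σ (Γ.hist σ ω m)), fun n => unif ω.2 (n + m)) := by
  induction m with
  | zero => rfl
  | succ m ih =>
    rw [Function.iterate_succ_apply', ih]
    have hs : Γ.step (Γ.state σ ω m, Γ.cont σ (Γ.hist σ ω m)) (unif ω.2 m) =
        (Γ.state σ ω (m + 1), Γ.cont σ (Γ.hist σ ω (m + 1))) := by
      refine Prod.ext ?_ ?_
      · simp [step, state, traj, cont, hist]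
      · funext h
        simp [step, state, traj, cont, hist]
    refine Prod.ext ?_ ?_
    · simp only [th, zero_add]; exact hs
    · funext n
      simp only [th, shiftSeq]
      congr 1; omega

lemma gw_iter (σ : Γ.Strategy) (ω : Γ.Env) (m : ℕ) :
    Γ.gw (Γ.th^[m] (Γ.ini σ ω)) = Γ.rew σ ω m := by
  rw [th_iter]; simp [gw, gf, cont, rew, act]

lemma avg_eq (σ : Γ.Strategy) (ω : Γ.Env) : Γ.avg σ ω = bav Γ.th Γ.gw (Γ.ini σ ω) := by
  funext n
  simp only [avg, bav, gw_iter]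

/-- Transition operator on measures. -/
noncomputable def Pk (κ : Measure (Γ.K × Γ.Strategy)) : Measure (Γ.K × Γ.Strategy) :=
  (κ.prod rho).map (fun w => Γ.step w.1 w.2)

instance (κ : Measure (Γ.K × Γ.Strategy)) [IsFiniteMeasure κ] : IsFiniteMeasure (Γ.Pk κ) := by
  unfold Pk; infer_instance

lemma map_th (κ : Measure (Γ.K × Γ.Strategy)) [IsFiniteMeasure κ] :
    (κ.prod noise).map Γ.th = (Γ.Pk κ).prod noise := by
  have hu : Measurable (fun u : ℕ → ℝ => (u 0, shiftSeq u)) :=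
    (measurable_pi_apply 0).prodMk measurable_shiftSeq
  have h1 := Measure.map_prod_map κ noise (measurable_id) hu
  rw [Measure.map_id, map_uncons] at h1
  have h2 := Measure.prodAssoc_prod (μ := κ) (ν := rho) (τ := noise)
  have h3 := Measure.map_prod_map (κ.prod rho) noise Γ.measurable_step measurable_id
  rw [Measure.map_id] at h3
  have h4 : (κ.prod rho).prod noise = (κ.prod (rho.prod noise)).map MeasurableEquiv.prodAssoc.symm := by
    rw [← h2, Measure.map_map (by fun_prop) (by fun_prop)]; simp
  unfold Pk
  rw [h3, h4, h1, Measure.map_map (Γ.measurable_step.prodMap measurable_id) (by fun_prop), Measure.map_map]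
  · rfl
  · exact (Γ.measurable_step.prodMap measurable_id).comp (by fun_prop)
  · exact measurable_id.prodMap hu

lemma finite_Pk_iter (κ : Measure (Γ.K × Γ.Strategy)) [IsFiniteMeasure κ] (m : ℕ) :
    IsFiniteMeasure (Γ.Pk^[m] κ) := by
  induction m with
  | zero => simpa
  | succ m ih => rw [Function.iterate_succ_apply']; infer_instance

lemma map_th_iter (κ : Measure (Γ.K × Γ.Strategy)) [IsFiniteMeasure κ] (m : ℕ) :
    (κ.prod noise).map (Γ.th^[m]) = (Γ.Pk^[m] κ).prod noise := by
  induction m with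
  | zero => simp
  | succ m ih =>
    have := Γ.finite_Pk_iter κ m
    rw [Function.iterate_succ', Function.iterate_succ_apply', ← map_th, ← ih,
      Measure.map_map Γ.measurable_th (Γ.measurable_th.iterate m)]

/-- Initial law. -/
noncomputable def init (p : Γ.K → ℝ) (σ : Γ.Strategy) : Measure (Γ.K × Γ.Strategy) :=
  (vecMeasure p).map (fun k => (k, σ))

instance (p : Γ.K → ℝ) : IsFiniteMeasure (vecMeasure p) := ⟨by
  simp only [vecMeasure, Measure.coe_finsetSum, Finset.sum_apply, Measure.smul_apply, measure_univ,
      smul_eq_mul, mul_one]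
  exact ENNReal.sum_lt_top.2 fun k _ => ENNReal.ofReal_lt_top⟩
instance (p : Γ.K → ℝ) (σ : Γ.Strategy) : IsFiniteMeasure (Γ.init p σ) := by
  unfold init; infer_instance

instance (p : Γ.K → ℝ) : IsFiniteMeasure (Γ.envMeasure p) := by
  unfold envMeasure; infer_instance

lemma measurable_ini (σ : Γ.Strategy) : Measurable (Γ.ini σ) := 
  (measurable_fst.prodMk measurable_const).prodMk (measurable_unif.comp measurable_snd)

lemma map_ini (p : Γ.K → ℝ) (σ : Γ.Strategy) :
    (Γ.envMeasure p).map (Γ.ini σ) = (Γ.init p σ).prod noise := by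
  unfold init
  rw [← map_unif, Measure.map_prod_map _ _ (by fun_prop) measurable_unif]
  rfl

lemma envMeasure_prob {p : Γ.K → ℝ} (hp : IsBelief p) : IsProbabilityMeasure (Γ.envMeasure p) := by
  have : IsProbabilityMeasure (vecMeasure p) := ⟨by
    simp only [vecMeasure, Measure.coe_finsetSum, Finset.sum_apply, Measure.smul_apply, measure_univ,
      smul_eq_mul, mul_one]
    rw [← ENNReal.ofReal_sum_of_nonneg fun k _ => hp.1 k, hp.2]; simp⟩
  have h2 : IsProbabilityMeasure (volume.restrict (Set.Ico (0 : ℝ) 1)) :=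
    inferInstanceAs (IsProbabilityMeasure lam)
  unfold envMeasure; infer_instance

lemma integral_init {p : Γ.K → ℝ} (hp : ∀ k, 0 ≤ p k) (σ : Γ.Strategy) {F : Γ.K × Γ.Strategy → ℝ}
    (hF : Measurable F) : ∫ z, F z ∂(Γ.init p σ) = ∑ k, p k * F (k, σ) := by
  unfold init
  rw [integral_map (by fun_prop) hF.aestronglyMeasurable]
  unfold vecMeasure
  rw [integral_finsetSum_measure]
  · refine Finset.sum_congr rfl fun k _ => ?_
    rw [integral_smul_measure, integral_dirac]; simp [hp k]
  · intro k _
    exact (integrable_dirac (by simp)).smul_measure (by simp)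

lemma measurable_state_cont (σ : Γ.Strategy) (m : ℕ) :
    Measurable (fun ω => (Γ.state σ ω m, Γ.cont σ (Γ.hist σ ω m))) := by
  have : (fun ω => (Γ.state σ ω m, Γ.cont σ (Γ.hist σ ω m))) =
      fun ω => (Γ.th^[m] (Γ.ini σ ω)).1 := by funext ω; rw [th_iter]
  rw [this]
  exact measurable_fst.comp ((Γ.measurable_th.iterate m).comp (Γ.measurable_ini σ))

lemma map_state_cont (p : Γ.K → ℝ) (σ : Γ.Strategy) (m : ℕ) :
    (Γ.envMeasure p).map (fun ω => (Γ.state σ ω m, Γ.cont σ (Γ.hist σ ω m))) =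
      Γ.Pk^[m] (Γ.init p σ) := by
  have : (fun ω => (Γ.state σ ω m, Γ.cont σ (Γ.hist σ ω m))) =
      Prod.fst ∘ (Γ.th^[m] ∘ (Γ.ini σ)) := by funext ω; simp [th_iter]
  have hf := Γ.finite_Pk_iter (Γ.init p σ) m
  rw [this, ← Measure.map_map measurable_fst ((Γ.measurable_th.iterate m).comp (Γ.measurable_ini σ)),
    ← Measure.map_map (Γ.measurable_th.iterate m) (Γ.measurable_ini σ), map_ini, map_th_iter,
    Measure.map_fst_prod]
  simp

/-- liminf on the skew product -/
noncomputable def lL (w : (Γ.K × Γ.Strategy) × (ℕ → ℝ)) : ℝ := liminf (bav Γ.th Γ.gw w) atTop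

lemma measurable_lL : Measurable Γ.lL :=
  Measurable.liminf (fun n => measurable_bav Γ.measurable_th Γ.measurable_gw n)

lemma lL_mem (w) : 0 ≤ Γ.lL w ∧ Γ.lL w ≤ 1 :=
  liminf_mem (bav_nonneg Γ.gw_nonneg w) (bav_le_one Γ.gw_le_one w)

lemma lL_inv (w) : Γ.lL (Γ.th w) = Γ.lL w := liminf_bav_inv Γ.gw_nonneg Γ.gw_le_one w

lemma integrable_lL (μ : Measure ((Γ.K × Γ.Strategy) × (ℕ → ℝ))) [IsFiniteMeasure μ] :
    Integrable Γ.lL μ :=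
  integrable_of_mem01 Γ.measurable_lL (fun w => (Γ.lL_mem w).1) (fun w => (Γ.lL_mem w).2)

/-- expected liminf -/
noncomputable def ell (z : Γ.K × Γ.Strategy) : ℝ := ∫ u, Γ.lL (z, u) ∂noise

lemma measurable_ell : Measurable Γ.ell :=
  (Γ.measurable_lL.stronglyMeasurable.integral_prod_right' (ν := noise)).measurable

lemma ell_nonneg (z) : 0 ≤ Γ.ell z := integral_nonneg fun u => (Γ.lL_mem _).1

lemma ell_le_one (z) : Γ.ell z ≤ 1 := by
  have h : ∫ u, Γ.lL (z, u) ∂noise ≤ ∫ u, (1 : ℝ) ∂noise := by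
    apply integral_mono _ (integrable_const _) fun u => (Γ.lL_mem _).2
    exact integrable_of_mem01 (Γ.measurable_lL.comp measurable_prodMk_left)
      (fun w => (Γ.lL_mem _).1) (fun w => (Γ.lL_mem _).2)
  unfold ell; simpa using h

lemma integral_ell (κ : Measure (Γ.K × Γ.Strategy)) [IsFiniteMeasure κ] :
    ∫ z, Γ.ell z ∂κ = ∫ w, Γ.lL w ∂(κ.prod noise) := by
  rw [integral_prod _ (Γ.integrable_lL _)]; rfl

lemma integral_ell_Pk (κ : Measure (Γ.K × Γ.Strategy)) [IsFiniteMeasure κ] :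
    ∫ z, Γ.ell z ∂(Γ.Pk κ) = ∫ z, Γ.ell z ∂κ := by
  rw [integral_ell, integral_ell, ← map_th, integral_map Γ.measurable_th.aemeasurable
    Γ.measurable_lL.aestronglyMeasurable]
  simp only [lL_inv]

lemma integral_ell_Pk_iter (κ : Measure (Γ.K × Γ.Strategy)) [IsFiniteMeasure κ] (m : ℕ) :
    ∫ z, Γ.ell z ∂(Γ.Pk^[m] κ) = ∫ z, Γ.ell z ∂κ := by
  induction m with
  | zero => rfl
  | succ m ih =>
    have := Γ.finite_Pk_iter κ m
    rw [Function.iterate_succ_apply', integral_ell_Pk, ih]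

lemma liminf_avg (σ : Γ.Strategy) (ω : Γ.Env) :
    atTop.liminf (Γ.avg σ ω) = Γ.lL (Γ.ini σ ω) := by rw [avg_eq]; rfl

lemma pay_eq' (p : Γ.K → ℝ) (σ : Γ.Strategy) : Γ.pay p σ = ∫ z, Γ.ell z ∂(Γ.init p σ) := by
  unfold pay
  simp only [liminf_avg]
  rw [integral_ell, ← map_ini, integral_map (Γ.measurable_ini σ).aemeasurable
    Γ.measurable_lL.aestronglyMeasurable]

lemma pay_eq {p : Γ.K → ℝ} (hp : ∀ k, 0 ≤ p k) (σ : Γ.Strategy) :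
    Γ.pay p σ = ∑ k, p k * Γ.ell (k, σ) := by
  rw [pay_eq', integral_init _ hp _ Γ.measurable_ell]

lemma payK_eq (k : Γ.K) (σ : Γ.Strategy) : Γ.payK k σ = Γ.ell (k, σ) := by
  unfold payK
  rw [pay_eq _ (fun k' => by unfold diracBelief; split_ifs <;> simp)]
  simp [diracBelief]

/-- pay is the expected continuation payoff. -/
lemma pay_cont (p : Γ.K → ℝ) (σ : Γ.Strategy) (m : ℕ) :
    Γ.pay p σ = ∫ ω, Γ.ell (Γ.state σ ω m, Γ.cont σ (Γ.hist σ ω m)) ∂(Γ.envMeasure p) := by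
  rw [pay_eq', ← Γ.integral_ell_Pk_iter _ m, ← map_state_cont, integral_map
    (Γ.measurable_state_cont σ m).aemeasurable Γ.measurable_ell.aestronglyMeasurable]

/-- The transition operator on functions. -/
noncomputable def Pf (F : Γ.K × Γ.Strategy → ℝ) (z : Γ.K × Γ.Strategy) : ℝ :=
  ∫ r, F (Γ.step z r) ∂rho

lemma integral_Pk (κ : Measure (Γ.K × Γ.Strategy)) [IsFiniteMeasure κ]
    {F : Γ.K × Γ.Strategy → ℝ} (hF : Measurable F) {C : ℝ} (hC : ∀ z, |F z| ≤ C) :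
    ∫ z, F z ∂(Γ.Pk κ) = ∫ z, Γ.Pf F z ∂κ := by
  unfold Pk Pf
  rw [integral_map Γ.measurable_step.aemeasurable hF.aestronglyMeasurable, integral_prod]
  exact Integrable.of_bound (hF.comp Γ.measurable_step).aestronglyMeasurable C
    (ae_of_all _ fun w => hC _)

lemma continuous_Pf {F : Γ.K × Γ.Strategy → ℝ} (hF : Continuous F) {C : ℝ} (hC : ∀ z, |F z| ≤ C) :
    Continuous (Γ.Pf F) := by
  refine continuous_of_dominated (bound := fun _ => C) (fun z => ?_) (fun z => ?_)
    (integrable_const _) ?_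
  · exact (hF.measurable.comp (Γ.measurable_step.comp measurable_prodMk_left)).aestronglyMeasurable
  · exact ae_of_all _ fun r => hC _
  · exact ae_of_all _ fun r => hF.comp (Γ.continuous_step r)

end POMDP

end

section

namespace POMDP
variable (Γ : POMDP)

lemma pay_nonneg {p : Γ.K → ℝ} (hp : ∀ k, 0 ≤ p k) (σ : Γ.Strategy) : 0 ≤ Γ.pay p σ := by
  rw [Γ.pay_eq hp]
  exact Finset.sum_nonneg fun k _ => mul_nonneg (hp k) (Γ.ell_nonneg _)

lemma pay_le_one {p : Γ.K → ℝ} (hp : IsBelief p) (σ : Γ.Strategy) : Γ.pay p σ ≤ 1 := by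
  rw [Γ.pay_eq hp.1, ← hp.2]
  exact Finset.sum_le_sum fun k _ => mul_le_of_le_one_right (hp.1 k) (Γ.ell_le_one _)

lemma bdd_pay {p : Γ.K → ℝ} (hp : IsBelief p) : BddAbove (Set.range (Γ.pay p)) :=
  ⟨1, by rintro _ ⟨σ, rfl⟩; exact Γ.pay_le_one hp σ⟩

lemma pay_le_val {p : Γ.K → ℝ} (hp : IsBelief p) (σ : Γ.Strategy) : Γ.pay p σ ≤ Γ.val p :=
  le_ciSup (Γ.bdd_pay hp) σ

instance : Nonempty Γ.Strategy := ⟨fun _ => ⟨0, Γ.hA⟩⟩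

lemma val_le_one {p : Γ.K → ℝ} (hp : IsBelief p) : Γ.val p ≤ 1 :=
  ciSup_le fun σ => Γ.pay_le_one hp σ

lemma val_nonneg {p : Γ.K → ℝ} (hp : IsBelief p) : 0 ≤ Γ.val p :=
  (Γ.pay_nonneg hp.1 (Classical.arbitrary _)).trans (Γ.pay_le_val hp _)

lemma exists_pay {p : Γ.K → ℝ} {δ : ℝ} (hδ : 0 < δ) : ∃ σ, Γ.val p - δ < Γ.pay p σ :=
  exists_lt_of_lt_ciSup (by show Γ.val p - δ < Γ.val p; linarith)

lemma val_lip {p p' : Γ.K → ℝ} (hp : IsBelief p) (hp' : IsBelief p') :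
    Γ.val p ≤ Γ.val p' + ∑ k, |p k - p' k| := by
  refine ciSup_le fun σ => ?_
  have h1 := Γ.pay_le_val hp' σ
  have h2 : Γ.pay p σ ≤ Γ.pay p' σ + ∑ k, |p k - p' k| := by
    rw [Γ.pay_eq hp.1, Γ.pay_eq hp'.1, ← Finset.sum_add_distrib]
    refine Finset.sum_le_sum fun k _ => ?_
    have a := Γ.ell_nonneg (k, σ)
    have b := Γ.ell_le_one (k, σ)
    have c := le_abs_self (p k - p' k)
    have d := abs_nonneg (p k - p' k)
    nlinarith
  linarith

lemma hist_length (σ : Γ.Strategy) (ω : Γ.Env) (m : ℕ) : (Γ.hist σ ω m).length = m := by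
  induction m with
  | zero => rfl
  | succ m ih => 
    have : Γ.hist σ ω (m+1) = Γ.hist σ ω m ++ [(σ (Γ.hist σ ω m), (sampleOn (Γ.q (Γ.state σ ω m) (σ (Γ.hist σ ω m))) (unif ω.2 m)).2)] := rfl
    rw [this, List.length_append, ih]; rfl

lemma measurableSet_traj (σ : Γ.Strategy) (m : ℕ) (x : Γ.K × Γ.Hist) :
    MeasurableSet {ω | Γ.traj σ ω m = x} := by
  induction m generalizing x with
  | zero =>
    have : {ω | Γ.traj σ ω 0 = x} = Prod.fst ⁻¹' {k | (k, ([] : Γ.Hist)) = x} := rfl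
    rw [this]
    exact measurable_fst (Set.toFinite _).measurableSet
  | succ m ih =>
    have : {ω | Γ.traj σ ω (m+1) = x} = ⋃ y : Γ.K × Γ.Hist, {ω | Γ.traj σ ω m = y} ∩
        (fun ω : Γ.Env => sampleOn (Γ.q y.1 (σ y.2)) (unif ω.2 m)) ⁻¹'
          {s | (s.1, y.2 ++ [(σ y.2, s.2)]) = x} := by
      ext ω
      simp only [Set.mem_iUnion, Set.mem_inter_iff, Set.mem_preimage, Set.mem_ofPred_eq]
      constructor
      · intro h; exact ⟨_, rfl, h⟩
      · rintro ⟨y, rfl, h⟩; exact h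
    rw [this]
    refine MeasurableSet.iUnion fun y => (ih y).inter ?_
    have hm : Measurable (fun ω : Γ.Env => sampleOn (Γ.q y.1 (σ y.2)) (unif ω.2 m)) :=
      (measurable_sampleOn (Γ.q y.1 (σ y.2))).comp
        ((measurable_pi_apply m).comp (measurable_unif.comp measurable_snd))
    exact hm (Set.toFinite _).measurableSet

lemma measurableSet_traj_mem (σ : Γ.Strategy) (m : ℕ) (B : Set (Γ.K × Γ.Hist)) :
    MeasurableSet {ω | Γ.traj σ ω m ∈ B} := by
  have : {ω | Γ.traj σ ω m ∈ B} = ⋃ x ∈ B, {ω | Γ.traj σ ω m = x} := by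
    ext ω; simp
  rw [this]
  exact MeasurableSet.biUnion B.to_countable fun x _ => Γ.measurableSet_traj σ m x

lemma measurable_traj (σ : Γ.Strategy) (m : ℕ) {β : Type*} [MeasurableSpace β]
    (Φ : Γ.K × Γ.Hist → β) : Measurable (fun ω => Φ (Γ.traj σ ω m)) := fun B _ =>
  Γ.measurableSet_traj_mem σ m (Φ ⁻¹' B)

/-- Histories of length m. -/
noncomputable def Hm (m : ℕ) : Finset Γ.Hist := (List.finite_length_eq (Γ.A × Γ.S) m).toFinset

lemma mem_Hm {m : ℕ} {h : Γ.Hist} : h ∈ Γ.Hm m ↔ h.length = m := by simp [Hm]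

/-- Joint probability. -/
noncomputable def joint (p : Γ.K → ℝ) (σ : Γ.Strategy) (h : Γ.Hist) (k : Γ.K) : ℝ :=
  Γ.prob p σ {ω | Γ.hist σ ω h.length = h ∧ Γ.state σ ω h.length = k}

lemma integral_traj (p : Γ.K → ℝ) (σ : Γ.Strategy) (m : ℕ) (Φ : Γ.K → Γ.Hist → ℝ) :
    ∫ ω, Φ (Γ.state σ ω m) (Γ.hist σ ω m) ∂(Γ.envMeasure p) =
      ∑ h ∈ Γ.Hm m, ∑ k, Γ.joint p σ h k * Φ k h := by
  classical
  have hms : ∀ h k, MeasurableSet {ω | Γ.hist σ ω m = h ∧ Γ.state σ ω m = k} := fun h k => by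
    exact Γ.measurableSet_traj_mem σ m {x | x.2 = h ∧ x.1 = k}
  have h1 : ∀ ω, Φ (Γ.state σ ω m) (Γ.hist σ ω m) = ∑ h ∈ Γ.Hm m, ∑ k,
      {ω | Γ.hist σ ω m = h ∧ Γ.state σ ω m = k}.indicator (fun _ => Φ k h) ω := by
    intro ω
    rw [Finset.sum_eq_single (Γ.hist σ ω m), Finset.sum_eq_single (Γ.state σ ω m)]
    · rw [Set.indicator_of_mem]; exact ⟨rfl, rfl⟩
    · intro k _ hk
      rw [Set.indicator_of_notMem]; rintro ⟨_, h⟩; exact hk h.symm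
    · simp
    · intro h _ hh
      refine Finset.sum_eq_zero fun k _ => ?_
      rw [Set.indicator_of_notMem]; rintro ⟨h', _⟩; exact hh h'.symm
    · intro h; exact absurd (Γ.mem_Hm.2 (Γ.hist_length σ ω m)) h
  simp_rw [h1]
  rw [integral_finsetSum]
  · refine Finset.sum_congr rfl fun h hh => ?_
    rw [integral_finsetSum]
    · refine Finset.sum_congr rfl fun k _ => ?_
      rw [integral_indicator_const _ (hms h k), smul_eq_mul]
      have := Γ.mem_Hm.1 hh
      subst this
      rfl
    · intro k _
      exact (integrable_const _).indicator (hms h k)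
  · intro h _
    refine integrable_finsetSum _ fun k _ => (integrable_const _).indicator (hms h k)

lemma joint_nonneg (p : Γ.K → ℝ) (σ : Γ.Strategy) (h : Γ.Hist) (k : Γ.K) : 0 ≤ Γ.joint p σ h k :=
  ENNReal.toReal_nonneg

lemma histProb_nonneg (p : Γ.K → ℝ) (σ : Γ.Strategy) (h : Γ.Hist) : 0 ≤ Γ.histProb p σ h :=
  ENNReal.toReal_nonneg

lemma joint_le (p : Γ.K → ℝ) (σ : Γ.Strategy) (h : Γ.Hist) (k : Γ.K) :
    Γ.joint p σ h k ≤ Γ.histProb p σ h :=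
  ENNReal.toReal_mono (measure_ne_top _ _) (measure_mono fun _ hω => hω.1)

lemma histProb_eq (p : Γ.K → ℝ) (σ : Γ.Strategy) (h : Γ.Hist) :
    Γ.histProb p σ h = ∑ k, Γ.joint p σ h k := by
  classical
  have h1 := Γ.integral_traj p σ h.length (fun k h' => if h' = h then 1 else 0)
  have hms : MeasurableSet {ω | Γ.hist σ ω h.length = h} :=
    Γ.measurableSet_traj_mem σ h.length {x | x.2 = h}
  have h2 : ∫ ω, (if Γ.hist σ ω h.length = h then (1:ℝ) else 0) ∂(Γ.envMeasure p) =
      Γ.histProb p σ h := by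
    have : (fun ω => if Γ.hist σ ω h.length = h then (1:ℝ) else 0) =
      {ω | Γ.hist σ ω h.length = h}.indicator (fun _ => 1) := by
      funext ω; simp [Set.indicator]
    rw [this, integral_indicator_const _ hms, smul_eq_mul, mul_one]; rfl
  rw [← h2, h1, Finset.sum_eq_single h]
  · simp
  · intro b _ hb; simp [hb]
  · intro hh; exact absurd (Γ.mem_Hm.2 rfl) hh

lemma joint_eq (p : Γ.K → ℝ) (σ : Γ.Strategy) (h : Γ.Hist) (k : Γ.K) :
    Γ.joint p σ h k = Γ.histProb p σ h * Γ.belief p σ h k := by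
  rcases eq_or_ne (Γ.histProb p σ h) 0 with h0 | h0
  · rw [h0, zero_mul]; exact le_antisymm (h0 ▸ Γ.joint_le p σ h k) (Γ.joint_nonneg _ _ _ _)
  · unfold belief; rw [mul_div_cancel₀ _ h0]; rfl

lemma belief_isBelief (p : Γ.K → ℝ) (σ : Γ.Strategy) (h : Γ.Hist) (h0 : 0 < Γ.histProb p σ h) :
    IsBelief (Γ.belief p σ h) := by
  constructor
  · intro k; exact div_nonneg (Γ.joint_nonneg p σ h k) h0.le
  · have : ∑ k, Γ.belief p σ h k = (∑ k, Γ.joint p σ h k) / Γ.histProb p σ h := by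
      rw [Finset.sum_div]; rfl
    rw [this, ← histProb_eq, div_self h0.ne']

lemma integral_traj' (p : Γ.K → ℝ) (σ : Γ.Strategy) (m : ℕ) (Φ : Γ.K → Γ.Hist → ℝ) :
    ∫ ω, Φ (Γ.state σ ω m) (Γ.hist σ ω m) ∂(Γ.envMeasure p) =
      ∑ h ∈ Γ.Hm m, Γ.histProb p σ h * ∑ k, Γ.belief p σ h k * Φ k h := by
  rw [integral_traj]
  simp_rw [joint_eq, Finset.mul_sum, mul_assoc]

lemma integral_hist (p : Γ.K → ℝ) (σ : Γ.Strategy) (m : ℕ) (Ψ : Γ.Hist → ℝ) :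
    ∫ ω, Ψ (Γ.hist σ ω m) ∂(Γ.envMeasure p) =
      ∑ h ∈ Γ.Hm m, Γ.histProb p σ h * Ψ h := by
  rw [Γ.integral_traj p σ m (fun _ h => Ψ h)]
  simp_rw [← Finset.sum_mul, ← histProb_eq]

lemma sum_histProb {p : Γ.K → ℝ} (hp : IsBelief p) (σ : Γ.Strategy) (m : ℕ) :
    ∑ h ∈ Γ.Hm m, Γ.histProb p σ h = 1 := by
  have := Γ.envMeasure_prob hp
  have := Γ.integral_hist p σ m (fun _ => 1)
  simpa using this.symm

lemma pay_cont' (p : Γ.K → ℝ) (σ : Γ.Strategy) (m : ℕ) :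
    Γ.pay p σ = ∑ h ∈ Γ.Hm m, Γ.histProb p σ h * Γ.pay (Γ.belief p σ h) (Γ.cont σ h) := by
  rw [Γ.pay_cont p σ m, Γ.integral_traj' p σ m (fun k h => Γ.ell (k, Γ.cont σ h))]
  refine Finset.sum_congr rfl fun h _ => ?_
  rcases (Γ.histProb_nonneg p σ h).eq_or_lt with h0 | h0
  · rw [← h0]; simp
  · rw [Γ.pay_eq (Γ.belief_isBelief p σ h h0).1]

/-- (C) -/
lemma pay_le_integral_val (p : Γ.K → ℝ) (σ : Γ.Strategy) (m : ℕ) :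
    Γ.pay p σ ≤ ∑ h ∈ Γ.Hm m, Γ.histProb p σ h * Γ.val (Γ.belief p σ h) := by
  rw [Γ.pay_cont' p σ m]
  refine Finset.sum_le_sum fun h _ => ?_
  rcases (Γ.histProb_nonneg p σ h).eq_or_lt with h0 | h0
  · rw [← h0]; simp
  · exact mul_le_mul_of_nonneg_left (Γ.pay_le_val (Γ.belief_isBelief p σ h h0) _) h0.le

lemma traj_congr (σ σ' : Γ.Strategy) (ω : Γ.Env) (m : ℕ)
    (hσ : ∀ h : Γ.Hist, h.length < m → σ h = σ' h) : Γ.traj σ ω m = Γ.traj σ' ω m := by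
  induction m with
  | zero => rfl
  | succ m ih =>
    have h1 := ih fun h hh => hσ h (by omega)
    have h2 : σ (Γ.traj σ' ω m).2 = σ' (Γ.traj σ' ω m).2 := hσ _ (by
      have := Γ.hist_length σ' ω m
      unfold hist at this
      omega)
    simp only [traj, h1, h2]

/-- (B) -/
lemma integral_val_le {p : Γ.K → ℝ} (hp : IsBelief p) (σ : Γ.Strategy) (m : ℕ) :
    ∑ h ∈ Γ.Hm m, Γ.histProb p σ h * Γ.val (Γ.belief p σ h) ≤ Γ.val p := by
  refine le_of_forall_pos_le_add fun δ hδ => ?_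
  choose τ hτ using fun h : Γ.Hist => Γ.exists_pay (p := Γ.belief p σ h) hδ
  let σ' : Γ.Strategy := fun h => if h.length < m then σ h else τ (h.take m) (h.drop m)
  have htr : ∀ ω, Γ.traj σ ω m = Γ.traj σ' ω m := fun ω => Γ.traj_congr σ σ' ω m fun h hh => by
    simp [σ', hh]
  have hb : ∀ h ∈ Γ.Hm m, Γ.histProb p σ' h = Γ.histProb p σ h ∧
      Γ.belief p σ' h = Γ.belief p σ h := by
    intro h hh
    have hl := Γ.mem_Hm.1 hh
    have h1 : Γ.histProb p σ' h = Γ.histProb p σ h := by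
      simp only [histProb, prob, hist, hl, htr]
    refine ⟨h1, ?_⟩
    funext k
    unfold belief
    rw [h1]
    simp only [prob, hist, state, hl, htr]
  have h1 := Γ.pay_le_val hp σ'
  rw [Γ.pay_cont' p σ' m] at h1
  have h2 : ∑ h ∈ Γ.Hm m, Γ.histProb p σ h * (Γ.val (Γ.belief p σ h) - δ) ≤ 
      ∑ h ∈ Γ.Hm m, Γ.histProb p σ' h * Γ.pay (Γ.belief p σ' h) (Γ.cont σ' h) := by
    refine Finset.sum_le_sum fun h hh => ?_
    have hl := Γ.mem_Hm.1 hh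
    have hc : Γ.cont σ' h = τ h := by
      funext h'
      simp [cont, σ', hl.symm]
    rw [(hb h hh).1, (hb h hh).2, hc]
    exact mul_le_mul_of_nonneg_left (hτ h).le (Γ.histProb_nonneg _ _ _)
  simp_rw [mul_sub, Finset.sum_sub_distrib, ← Finset.sum_mul] at h2
  rw [Γ.sum_histProb hp, one_mul] at h2
  linarith

lemma integral_gf (p : Γ.K → ℝ) (σ : Γ.Strategy) (N : ℕ) :
    ∫ ω, Γ.avg σ ω N ∂(Γ.envMeasure p) =
      (1 / N : ℝ) * ∑ m ∈ Finset.range N, ∑ h ∈ Γ.Hm m, Γ.histProb p σ h *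
        ∑ k, Γ.belief p σ h k * Γ.gf (k, Γ.cont σ h) := by
  unfold avg
  rw [integral_const_mul, integral_finsetSum]
  · congr 1
    refine Finset.sum_congr rfl fun m _ => ?_
    rw [← Γ.integral_traj' p σ m (fun k h => Γ.gf (k, Γ.cont σ h))]
    simp [rew, act, gf, cont]
  · intro m _
    refine integrable_of_mem01 (Γ.measurable_traj σ m (fun x => Γ.g x.1 (σ x.2))) ?_ ?_
    · intro ω; exact Γ.g_nonneg _ _
    · intro ω; exact Γ.g_le_one _ _

/-- (D) -/
lemma fatou {p : Γ.K → ℝ} (σ : Γ.Strategy) {δ : ℝ} (hδ : 0 < δ) :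
    ∀ᶠ N in atTop, Γ.pay p σ - δ < ∫ ω, Γ.avg σ ω N ∂(Γ.envMeasure p) := by
  have hma : ∀ N, Measurable fun ω => Γ.avg σ ω N := fun N => by
    simp_rw [avg_eq]
    exact (measurable_bav Γ.measurable_th Γ.measurable_gw N).comp (Γ.measurable_ini σ)
  have hml : Measurable fun ω => Γ.lL (Γ.ini σ ω) := Γ.measurable_lL.comp (Γ.measurable_ini σ)
  have ha0 : ∀ ω N, 0 ≤ Γ.avg σ ω N := fun ω N => by
    rw [avg_eq]; exact bav_nonneg Γ.gw_nonneg _ _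
  have ha1 : ∀ ω N, Γ.avg σ ω N ≤ 1 := fun ω N => by
    rw [avg_eq]; exact bav_le_one Γ.gw_le_one _ _
  have hia : ∀ N, Integrable (fun ω => Γ.avg σ ω N) (Γ.envMeasure p) := fun N =>
    integrable_of_mem01 (hma N) (fun ω => ha0 ω N) (fun ω => ha1 ω N)
  have hil : Integrable (fun ω => Γ.lL (Γ.ini σ ω)) (Γ.envMeasure p) :=
    integrable_of_mem01 hml (fun ω => (Γ.lL_mem _).1) (fun ω => (Γ.lL_mem _).2)
  let f : ℕ → Γ.Env → ℝ := fun N ω => min (Γ.avg σ ω N - Γ.lL (Γ.ini σ ω)) 0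
  have hmf : ∀ N, Measurable (f N) := fun N => ((hma N).sub hml).min measurable_const
  have hfb : ∀ N ω, ‖f N ω‖ ≤ 1 := fun N ω => by
    have := ha0 ω N
    have := (Γ.lL_mem (Γ.ini σ ω))
    rw [Real.norm_eq_abs, abs_le]
    refine ⟨le_min (by linarith) (by norm_num), (min_le_right _ _).trans (by norm_num)⟩
  have hlim : Tendsto (fun N => ∫ ω, f N ω ∂(Γ.envMeasure p)) atTop (nhds (∫ ω, (0:ℝ) ∂(Γ.envMeasure p))) := by
    refine tendsto_integral_of_dominated_convergence (fun _ => (1:ℝ))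
      (fun N => (hmf N).aestronglyMeasurable) (integrable_const _)
      (fun N => ae_of_all _ (hfb N)) (ae_of_all _ fun ω => ?_)
    rw [Metric.tendsto_atTop']
    intro e he
    have hlt : Γ.lL (Γ.ini σ ω) - e < liminf (Γ.avg σ ω) atTop := by
      rw [liminf_avg]; linarith
    have hev := eventually_lt_of_lt_liminf hlt (by
      rw [avg_eq]; exact bdd_below (bav_nonneg Γ.gw_nonneg _))
    obtain ⟨N, hN⟩ := eventually_atTop.1 hev
    refine ⟨N, fun n hn => ?_⟩
    have := hN n hn.le
    rw [Real.dist_eq, sub_zero, abs_lt]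
    exact ⟨lt_min (by linarith) (by linarith), (min_le_right _ _).trans_lt he⟩
  rw [integral_zero] at hlim
  have hpay : Γ.pay p σ = ∫ ω, Γ.lL (Γ.ini σ ω) ∂(Γ.envMeasure p) := by
    unfold pay; simp_rw [liminf_avg]
  filter_upwards [hlim.eventually (lt_mem_nhds (show -δ < 0 by linarith))] with N hN
  have hif : Integrable (f N) (Γ.envMeasure p) :=
    Integrable.of_bound (hmf N).aestronglyMeasurable 1 (ae_of_all _ (hfb N))
  have h3 : ∫ ω, (Γ.lL (Γ.ini σ ω) + f N ω) ∂(Γ.envMeasure p) ≤ ∫ ω, Γ.avg σ ω N ∂(Γ.envMeasure p) := by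
    refine integral_mono (hil.add hif) (hia N) fun ω => ?_
    have : f N ω ≤ Γ.avg σ ω N - Γ.lL (Γ.ini σ ω) := min_le_left _ _
    simp only; linarith
  rw [integral_add hil hif] at h3
  linarith

end POMDP

end

section

lemma ibd {α : Type*} [MeasurableSpace α] {μ : Measure α} [IsFiniteMeasure μ] {F : α → ℝ}
    (hF : Measurable F) {C : ℝ} (hC : ∀ x, |F x| ≤ C) : Integrable F μ :=
  Integrable.of_bound hF.aestronglyMeasurable C (ae_of_all _ hC)

lemma map_eval_noise : noise.map (fun u => u 0) = rho := by
  have h := congrArg (Measure.map Prod.fst) map_uncons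
  rw [Measure.map_map measurable_fst ((measurable_pi_apply 0).prodMk measurable_shiftSeq),
    Measure.map_fst_prod] at h
  rw [measure_univ, one_smul] at h
  exact h

namespace POMDP
variable (Γ : POMDP)

lemma abs_ell (z) : |Γ.ell z| ≤ 1 := abs_le.2 ⟨by linarith [Γ.ell_nonneg z], Γ.ell_le_one z⟩
lemma abs_lL (w) : |Γ.lL w| ≤ 1 := abs_le.2 ⟨by linarith [(Γ.lL_mem w).1], (Γ.lL_mem w).2⟩
lemma abs_gf (z) : |Γ.gf z| ≤ 1 :=
  abs_le.2 ⟨by linarith [show 0 ≤ Γ.gf z from Γ.g_nonneg _ _], Γ.g_le_one _ _⟩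

lemma Pf_ell (z) : Γ.Pf Γ.ell z = Γ.ell z := by
  have h1 := Γ.integral_Pk (Measure.dirac z) Γ.measurable_ell Γ.abs_ell
  rw [integral_ell_Pk, integral_dirac, integral_dirac] at h1
  exact h1.symm

/-- (H) -/
lemma integral_mul_lL (κ : Measure (Γ.K × Γ.Strategy)) [IsFiniteMeasure κ]
    {F : Γ.K × Γ.Strategy → ℝ} (hF : Measurable F) (hC : ∀ z, |F z| ≤ 1) :
    ∫ w, F w.1 * Γ.lL w ∂(κ.prod noise) = ∫ w, F w.1 * Γ.ell w.1 ∂(κ.prod noise) := by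
  rw [integral_prod, integral_prod]
  · refine integral_congr_ae (ae_of_all _ fun z => ?_)
    simp only [integral_const_mul, integral_const, probReal_univ, one_smul]
    rfl
  · refine ibd ((hF.comp measurable_fst).mul (Γ.measurable_ell.comp measurable_fst)) (C := 1) fun w => ?_
    rw [abs_mul]; exact mul_le_one₀ (hC _) (abs_nonneg _) (Γ.abs_ell _)
  · refine ibd ((hF.comp measurable_fst).mul (Γ.measurable_lL)) (C := 1) fun w => ?_
    rw [abs_mul]; exact mul_le_one₀ (hC _) (abs_nonneg _) (Γ.abs_lL _)

lemma integral_mul_th (κ : Measure (Γ.K × Γ.Strategy)) [IsFiniteMeasure κ]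
    {F : Γ.K × Γ.Strategy → ℝ} (hF : Measurable F) (hC : ∀ z, |F z| ≤ 1) :
    ∫ w, F w.1 * Γ.ell (Γ.th w).1 ∂(κ.prod noise) = ∫ w, F w.1 * Γ.ell w.1 ∂(κ.prod noise) := by
  rw [integral_prod, integral_prod]
  · refine integral_congr_ae (ae_of_all _ fun z => ?_)
    simp only [integral_const_mul, integral_const, probReal_univ, one_smul]
    congr 1
    have h := Γ.Pf_ell z
    unfold Pf at h
    rw [← map_eval_noise, integral_map (measurable_pi_apply 0).aemeasurable] at h
    · exact h
    · exact (Γ.measurable_ell.comp (Γ.measurable_step.comp measurable_prodMk_left)).aestronglyMeasurable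
  · refine ibd ((hF.comp measurable_fst).mul (Γ.measurable_ell.comp measurable_fst)) (C := 1) fun w => ?_
    rw [abs_mul]; exact mul_le_one₀ (hC _) (abs_nonneg _) (Γ.abs_ell _)
  · refine ibd ((hF.comp measurable_fst).mul (Γ.measurable_ell.comp (measurable_fst.comp Γ.measurable_th)))
      (C := 1) fun w => ?_
    rw [abs_mul]; exact mul_le_one₀ (hC _) (abs_nonneg _) (Γ.abs_ell _)

lemma ae_zero_of_sq {α : Type*} [MeasurableSpace α] {μ : Measure α} [IsFiniteMeasure μ] {F : α → ℝ}
    (hF : Measurable F) {C : ℝ} (hC : ∀ x, |F x| ≤ C) (h : ∫ x, F x ^ 2 ∂μ = 0) : ∀ᵐ x ∂μ, F x = 0 := by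
  rw [integral_eq_zero_iff_of_nonneg (fun x => sq_nonneg _)
    (ibd (hF.pow_const 2) (C := C ^ 2) fun x => by rw [abs_pow]; exact pow_le_pow_left₀ (abs_nonneg _) (hC x) 2)] at h
  filter_upwards [h] with x hx
  simpa using hx

lemma ergodic_part (κ : Measure (Γ.K × Γ.Strategy)) [IsProbabilityMeasure κ] (hκ : Γ.Pk κ = κ) :
    (∀ᵐ w ∂(κ.prod noise), Tendsto (bav Γ.th Γ.gw w) atTop (nhds (Γ.ell w.1))) ∧
      ∫ z, Γ.ell z ∂κ = ∫ z, Γ.gf z ∂κ := by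
  set ν := κ.prod noise with hν
  have hmp : MeasurePreserving Γ.th ν ν := ⟨Γ.measurable_th, by rw [hν, map_th, hκ]⟩
  obtain ⟨hb1, hb2⟩ := birkhoff hmp Γ.measurable_gw Γ.gw_nonneg Γ.gw_le_one
  let e : (Γ.K × Γ.Strategy) × (ℕ → ℝ) → ℝ := fun w => Γ.ell w.1
  have hme : Measurable e := Γ.measurable_ell.comp measurable_fst
  have hbe : ∀ w, |e w| ≤ 1 := fun w => Γ.abs_ell _
  have hmet : Measurable (fun w => e (Γ.th w)) := hme.comp Γ.measurable_th
  have hprod : ∀ {F G : (Γ.K × Γ.Strategy) × (ℕ → ℝ) → ℝ} (_ : Measurable F) (_ : Measurable G)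
      (_ : ∀ w, |F w| ≤ 1) (_ : ∀ w, |G w| ≤ 1), Integrable (fun w => F w * G w) ν := by
    intro F G hF hG hF1 hG1
    refine ibd (hF.mul hG) (C := 1) fun w => ?_
    rw [abs_mul]; exact mul_le_one₀ (hF1 _) (abs_nonneg _) (hG1 _)
  have i1 : Integrable (fun w => e w * e w) ν := hprod hme hme hbe hbe
  have i2 : Integrable (fun w => e w * e (Γ.th w)) ν := hprod hme hmet hbe (fun w => hbe _)
  have i3 : Integrable (fun w => e (Γ.th w) * e (Γ.th w)) ν := hprod hmet hmet (fun w => hbe _) (fun w => hbe _)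
  have i4 : Integrable (fun w => Γ.lL w * Γ.lL w) ν := hprod Γ.measurable_lL Γ.measurable_lL Γ.abs_lL Γ.abs_lL
  have i5 : Integrable (fun w => e w * Γ.lL w) ν := hprod hme Γ.measurable_lL hbe Γ.abs_lL
  have e1 : ∀ᵐ w ∂ν, e (Γ.th w) - e w = 0 := by
    refine ae_zero_of_sq (hmet.sub hme) (C := 2) (fun w => ?_) ?_
    · have a := abs_le.1 (hbe w); have b := abs_le.1 (hbe (Γ.th w))
      exact abs_le.2 ⟨by linarith, by linarith⟩
    · have a : ∫ w, e w * e (Γ.th w) ∂ν = ∫ w, e w * e w ∂ν :=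
        Γ.integral_mul_th κ Γ.measurable_ell Γ.abs_ell
      have b : ∫ w, e (Γ.th w) * e (Γ.th w) ∂ν = ∫ w, e w * e w ∂ν := by
        have := integral_map (μ := ν) (f := fun w => e w * e w) Γ.measurable_th.aemeasurable
          (hme.mul hme).aestronglyMeasurable
        rw [hmp.map_eq] at this
        exact this.symm
      have c : ∀ w, (e (Γ.th w) - e w) ^ 2 =
          e (Γ.th w) * e (Γ.th w) - 2 * (e w * e (Γ.th w)) + e w * e w := fun w => by ring
      simp_rw [c]
      have i6 : Integrable (fun w => e (Γ.th w) * e (Γ.th w) - 2 * (e w * e (Γ.th w))) ν :=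
        i3.sub (i2.const_mul 2)
      rw [integral_add i6 i1, integral_sub i3 (i2.const_mul 2),
        integral_const_mul, a, b]
      ring
  have e2 : ∀ n : ℕ, ∀ᵐ w ∂ν, e (Γ.th^[n] w) = e w := by
    intro n
    induction n with
    | zero => simp
    | succ n ih =>
      filter_upwards [ih, (hmp.iterate n).quasiMeasurePreserving.ae e1] with w h1 h2
      rw [Function.iterate_succ_apply', ← h1]; linarith
  let D : (Γ.K × Γ.Strategy) × (ℕ → ℝ) → ℝ := fun w => Γ.lL w - e w
  have hmD : Measurable D := Γ.measurable_lL.sub hme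
  have hD1 : ∀ w, |D w| ≤ 1 := fun w => by
    have a := Γ.lL_mem w
    have b := Γ.ell_nonneg w.1
    have c := Γ.ell_le_one w.1
    exact abs_le.2 ⟨by simp only [D, e]; linarith, by simp only [D, e]; linarith⟩
  have hL : ∀ n w, Γ.lL (Γ.th^[n] w) = Γ.lL w := by
    intro n w
    induction n with
    | zero => rfl
    | succ n ih => rw [Function.iterate_succ_apply', lL_inv, ih]
  have hgw1 : ∀ w, |Γ.gw w| ≤ 1 := fun w => Γ.abs_gf _
  have hDg : ∀ n : ℕ, ∫ w, D w * Γ.gw (Γ.th^[n] w) ∂ν = 0 := by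
    intro n
    have h1 : ∫ w, D w * Γ.gw (Γ.th^[n] w) ∂ν = ∫ w, D (Γ.th^[n] w) * Γ.gw (Γ.th^[n] w) ∂ν := by
      refine integral_congr_ae ?_
      filter_upwards [e2 n] with w hw
      simp only [D, hL, hw]
    have h2 := integral_map (μ := ν) (f := fun w => D w * Γ.gw w) (Γ.measurable_th.iterate n).aemeasurable
          (hmD.mul Γ.measurable_gw).aestronglyMeasurable
    rw [(hmp.iterate n).map_eq] at h2
    rw [h1, ← h2]
    have h3 : ∀ w, D w * Γ.gw w = Γ.gf w.1 * Γ.lL w - Γ.gf w.1 * Γ.ell w.1 := fun w => by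
      simp only [D, e, gw]; ring
    simp_rw [h3]
    have i6 : Integrable (fun w => Γ.gf w.1 * Γ.lL w) ν :=
      hprod Γ.measurable_gw Γ.measurable_lL hgw1 Γ.abs_lL
    have i7 : Integrable (fun w => Γ.gf w.1 * Γ.ell w.1) ν := hprod Γ.measurable_gw hme hgw1 hbe
    rw [integral_sub i6 i7,
      Γ.integral_mul_lL κ Γ.measurable_gf Γ.abs_gf, sub_self]
  have hDb : ∀ n : ℕ, ∫ w, D w * bav Γ.th Γ.gw w n ∂ν = 0 := by
    intro n
    have h1 : ∀ w, D w * bav Γ.th Γ.gw w n = (1 / n : ℝ) *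
        ∑ m ∈ Finset.range n, D w * Γ.gw (Γ.th^[m] w) := fun w => by
      unfold bav; rw [← Finset.mul_sum]; ring
    simp_rw [h1]
    rw [integral_const_mul, integral_finsetSum]
    · simp [hDg]
    · intro m _
      exact hprod hmD (Γ.measurable_gw.comp (Γ.measurable_th.iterate m)) hD1 (fun w => hgw1 _)
  have hDL : ∫ w, D w * Γ.lL w ∂ν = 0 := by
    have h1 : Tendsto (fun n => ∫ w, D w * bav Γ.th Γ.gw w n ∂ν) atTop (nhds (∫ w, D w * Γ.lL w ∂ν)) := by
      refine tendsto_integral_of_dominated_convergence (fun _ => (1:ℝ))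
        (fun n => (hmD.mul (measurable_bav Γ.measurable_th Γ.measurable_gw n)).aestronglyMeasurable)
        (integrable_const _) (fun n => ae_of_all _ fun w => ?_) ?_
      · rw [norm_mul]
        refine mul_le_one₀ (hD1 _) (abs_nonneg _) ?_
        have a := bav_nonneg (T := Γ.th) Γ.gw_nonneg w n
        have b := bav_le_one (T := Γ.th) Γ.gw_le_one w n
        exact abs_le.2 ⟨by linarith, b⟩
      · filter_upwards [hb1] with w hw
        exact hw.const_mul _
    simp_rw [hDb] at h1
    exact tendsto_nhds_unique h1 tendsto_const_nhds
  have hDe : ∫ w, e w * Γ.lL w ∂ν = ∫ w, e w * e w ∂ν := Γ.integral_mul_lL κ Γ.measurable_ell Γ.abs_ell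
  have hD0 : ∀ᵐ w ∂ν, D w = 0 := by
    refine ae_zero_of_sq hmD hD1 ?_
    have c : ∀ w, D w ^ 2 = D w * Γ.lL w - (e w * Γ.lL w - e w * e w) := fun w => by
      simp only [D]; ring
    simp_rw [c]
    have i6 : Integrable (fun w => e w * Γ.lL w - e w * e w) ν := i5.sub i1
    rw [integral_sub (hprod hmD Γ.measurable_lL hD1 Γ.abs_lL) i6, integral_sub i5 i1, hDL, hDe]
    ring
  constructor
  · filter_upwards [hb1, hD0] with w h1 h2
    have : Γ.ell w.1 = liminf (bav Γ.th Γ.gw w) atTop := by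
      simp only [D, e, lL] at h2; linarith
    rw [this]; exact h1
  · rw [integral_ell]
    have : ∫ w, Γ.gw w ∂ν = ∫ z, Γ.gf z ∂κ := by
      rw [integral_prod _ (ibd Γ.measurable_gw hgw1)]
      simp [gw]
    rw [← this]; exact hb2

end POMDP

end

section

namespace POMDP
variable (Γ : POMDP)

/-- belief-strategy space -/
abbrev Y := stdSimplex ℝ Γ.K × Γ.Strategy

/-- Good beliefs. -/
def Good (p : Γ.K → ℝ) : Prop := ∃ σ : Γ.Strategy,
          (∀ k, 0 < p k →
            ∀ᵐ ω ∂(Γ.envMeasure (diracBelief k)),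
              Tendsto (Γ.avg σ ω) atTop (nhds (Γ.payK k σ))) ∧
          Γ.pay p σ = Γ.val p

lemma isB (p : stdSimplex ℝ Γ.K) : IsBelief p.1 := p.2

lemma continuous_co (k : Γ.K) : Continuous fun p : stdSimplex ℝ Γ.K => p.1 k :=
  (continuous_apply k).comp continuous_subtype_val

lemma continuous_val : Continuous fun p : stdSimplex ℝ Γ.K => Γ.val p.1 := by
  rw [continuous_iff_continuousAt]
  intro p
  have h0 : Tendsto (fun q : stdSimplex ℝ Γ.K => ∑ k, |q.1 k - p.1 k|) (nhds p) (nhds 0) := by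
    have : Continuous fun q : stdSimplex ℝ Γ.K => ∑ k, |q.1 k - p.1 k| :=
      continuous_finsetSum _ fun k _ => ((Γ.continuous_co k).sub continuous_const).abs
    simpa using this.tendsto p
  refine tendsto_iff_dist_tendsto_zero.2 (squeeze_zero (fun _ => dist_nonneg) (fun q => ?_) h0)
  rw [Real.dist_eq, abs_le]
  have h1 := Γ.val_lip (Γ.isB q) (Γ.isB p)
  have h2 := Γ.val_lip (Γ.isB p) (Γ.isB q)
  simp_rw [abs_sub_comm (p.1 _)] at h2
  constructor <;> linarith

/-- The state-strategy measure associated to a belief-strategy measure. -/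
noncomputable def kap (μ : Measure Γ.Y) : Measure (Γ.K × Γ.Strategy) :=
  ∑ k, (μ.withDensity fun y => ENNReal.ofReal (y.1.1 k)).map (fun y => (k, y.2))

lemma measurable_coord (k : Γ.K) : Measurable fun y : Γ.Y => y.1.1 k := by
  have : Continuous fun y : Γ.Y => y.1.1 k := (Γ.continuous_co k).comp continuous_fst
  exact this.measurable

lemma coord_nonneg (y : Γ.Y) (k) : 0 ≤ y.1.1 k := (Γ.isB y.1).1 k
lemma coord_le_one (y : Γ.Y) (k) : y.1.1 k ≤ 1 := by
  rw [← (Γ.isB y.1).2]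
  exact Finset.single_le_sum (fun i _ => Γ.coord_nonneg y i) (Finset.mem_univ k)

lemma measurable_mk (k : Γ.K) : Measurable fun y : Γ.Y => (k, y.2) :=
  measurable_const.prodMk measurable_snd

lemma finite_wd (μ : Measure Γ.Y) [IsFiniteMeasure μ] (k) :
    IsFiniteMeasure (μ.withDensity fun y => ENNReal.ofReal (y.1.1 k)) := by
  refine isFiniteMeasure_withDensity_ofReal (Integrable.hasFiniteIntegral (ibd (Γ.measurable_coord k) (C := 1) fun y => ?_))
  rw [abs_of_nonneg (Γ.coord_nonneg y k)]; exact Γ.coord_le_one y k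

lemma integral_kap (μ : Measure Γ.Y) [IsFiniteMeasure μ] {F : Γ.K × Γ.Strategy → ℝ}
    (hF : Measurable F) {C : ℝ} (hC : ∀ z, |F z| ≤ C) :
    ∫ z, F z ∂(Γ.kap μ) = ∫ y, ∑ k, y.1.1 k * F (k, y.2) ∂μ := by
  unfold kap
  have := Γ.finite_wd μ
  rw [integral_finsetSum_measure, integral_finsetSum]
  · refine Finset.sum_congr rfl fun k _ => ?_
    rw [integral_map (Γ.measurable_mk k).aemeasurable hF.aestronglyMeasurable]
    rw [integral_withDensity_eq_integral_toReal_smul (Γ.measurable_coord k).ennreal_ofReal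
      (ae_of_all _ fun y => ENNReal.ofReal_lt_top)]
    simp [ENNReal.toReal_ofReal (Γ.coord_nonneg _ _)]
  · intro k _
    refine ibd ((Γ.measurable_coord k).mul (hF.comp (Γ.measurable_mk k))) (C := C) fun y => ?_
    rw [abs_mul, abs_of_nonneg (Γ.coord_nonneg y k)]
    exact (mul_le_of_le_one_left (abs_nonneg _) (Γ.coord_le_one y k)).trans (hC _)
  · intro k _
    exact ibd hF hC

instance (μ : Measure Γ.Y) [IsFiniteMeasure μ] : IsFiniteMeasure (Γ.kap μ) := by
  have := Γ.finite_wd μ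
  refine ⟨?_⟩
  unfold kap
  rw [Measure.coe_finsetSum, Finset.sum_apply]
  exact ENNReal.sum_lt_top.2 fun k _ => measure_lt_top _ _

lemma kap_prob (μ : Measure Γ.Y) [IsProbabilityMeasure μ] : IsProbabilityMeasure (Γ.kap μ) := by
  have h := Γ.integral_kap μ (F := fun _ => 1) measurable_const (C := 1) (by simp)
  have h1 : ∀ y : Γ.Y, ∑ k, y.1.1 k = 1 := fun y => (Γ.isB y.1).2
  simp only [mul_one, h1, integral_const, smul_eq_mul, probReal_univ] at h
  rw [measureReal_def, ENNReal.toReal_eq_one_iff] at h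
  exact ⟨h⟩

lemma ae_kap (μ : Measure Γ.Y) {Q : Γ.K × Γ.Strategy → Prop} (h : ∀ᵐ z ∂(Γ.kap μ), Q z) :
    ∀ᵐ y ∂μ, ∀ k, 0 < y.1.1 k → Q (k, y.2) := by
  rw [ae_all_iff]
  intro k
  have hle : (μ.withDensity fun y => ENNReal.ofReal (y.1.1 k)).map (fun y => (k, y.2)) ≤ Γ.kap μ := by
    unfold kap
    exact Finset.single_le_sum (f := fun k =>
      (μ.withDensity fun y => ENNReal.ofReal (y.1.1 k)).map (fun y => (k, y.2)))
      (fun _ _ => Measure.zero_le _) (Finset.mem_univ k)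
  have h2 := ae_of_ae_map (Γ.measurable_mk k).aemeasurable (ae_mono hle h)
  rw [ae_withDensity_iff (Γ.measurable_coord k).ennreal_ofReal] at h2
  filter_upwards [h2] with y hy hk
  exact hy (by simpa using hk)

lemma init_dirac (k : Γ.K) (σ : Γ.Strategy) : Γ.init (diracBelief k) σ = Measure.dirac (k, σ) := by
  unfold init
  have : vecMeasure (diracBelief k) = Measure.dirac k := by
    unfold vecMeasure diracBelief
    rw [Finset.sum_eq_single k]
    · simp
    · intro b _ hb; simp [hb]
    · simp
  rw [this, Measure.map_dirac' (by fun_prop)]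

lemma ae_env (k : Γ.K) (σ : Γ.Strategy)
    (h : ∀ᵐ u ∂noise, Tendsto (bav Γ.th Γ.gw ((k, σ), u)) atTop (nhds (Γ.ell (k, σ)))) :
    ∀ᵐ ω ∂(Γ.envMeasure (diracBelief k)), Tendsto (Γ.avg σ ω) atTop (nhds (Γ.payK k σ)) := by
  have hms : MeasurableSet {w | Tendsto (fun n => bav Γ.th Γ.gw w n) atTop (nhds (Γ.ell (k, σ)))} :=
    measurableSet_tendsto _ fun n => measurable_bav Γ.measurable_th Γ.measurable_gw n
  have h1 : ∀ᵐ w ∂((Γ.init (diracBelief k) σ).prod noise),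
      Tendsto (fun n => bav Γ.th Γ.gw w n) atTop (nhds (Γ.ell (k, σ))) := by
    rw [init_dirac, Measure.dirac_prod]
    exact (ae_map_iff measurable_prodMk_left.aemeasurable hms).2 h
  rw [← map_ini] at h1
  have h2 := ae_of_ae_map (Γ.measurable_ini σ).aemeasurable h1
  filter_upwards [h2] with ω hω
  rw [payK_eq, avg_eq]; exact hω

lemma ae_good (μ : Measure Γ.Y) [IsProbabilityMeasure μ] {v : ℝ}
    (ha : ∀ F : Γ.K × Γ.Strategy → ℝ, Continuous F →
      ∫ y, ∑ k, y.1.1 k * Γ.Pf F (k, y.2) ∂μ = ∫ y, ∑ k, y.1.1 k * F (k, y.2) ∂μ)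
    (hb : v ≤ ∫ y, ∑ k, y.1.1 k * Γ.gf (k, y.2) ∂μ)
    (hc : ∫ y, Γ.val y.1.1 ∂μ ≤ v) : ∀ᵐ y ∂μ, Γ.Good y.1.1 := by
  have hprob := Γ.kap_prob μ
  have hinv : Γ.Pk (Γ.kap μ) = Γ.kap μ := by
    refine ext_of_forall_integral_eq_of_IsFiniteMeasure fun f => ?_
    have hf : ∀ z, |f z| ≤ ‖f‖ := fun z => f.norm_coe_le_norm z
    have hPf : ∀ z, |Γ.Pf f z| ≤ ‖f‖ := fun z => by
      unfold Pf
      have := norm_integral_le_of_norm_le_const (μ := rho) (f := fun r => f (Γ.step z r)) (C := ‖f‖)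
        (ae_of_all _ fun r => hf _)
      simpa using this
    rw [Γ.integral_Pk _ f.continuous.measurable hf, Γ.integral_kap μ f.continuous.measurable hf,
      Γ.integral_kap μ (Γ.continuous_Pf f.continuous hf).measurable hPf]
    exact ha f f.continuous
  obtain ⟨h1, h2⟩ := Γ.ergodic_part (Γ.kap μ) hinv
  have h3 := Γ.ae_kap μ (Measure.ae_ae_of_ae_prod h1)
  rw [Γ.integral_kap μ Γ.measurable_ell Γ.abs_ell, Γ.integral_kap μ Γ.measurable_gf Γ.abs_gf] at h2
  have hpe : ∀ y : Γ.Y, ∑ k, y.1.1 k * Γ.ell (k, y.2) = Γ.pay y.1.1 y.2 := fun y =>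
    (Γ.pay_eq (Γ.isB y.1).1 _).symm
  have hmp : Measurable fun y : Γ.Y => Γ.pay y.1.1 y.2 := by
    simp_rw [← hpe]
    exact Finset.measurable_sum _ fun k _ =>
      (Γ.measurable_coord k).mul (Γ.measurable_ell.comp (Γ.measurable_mk k))
  simp_rw [hpe] at h2
  have hmv : Measurable fun y : Γ.Y => Γ.val y.1.1 :=
    (Γ.continuous_val.comp continuous_fst).measurable
  have ip : Integrable (fun y : Γ.Y => Γ.pay y.1.1 y.2) μ := integrable_of_mem01 hmp
    (fun y => Γ.pay_nonneg (Γ.isB _).1 _) (fun y => Γ.pay_le_one (Γ.isB _) _)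
  have iv : Integrable (fun y : Γ.Y => Γ.val y.1.1) μ := integrable_of_mem01 hmv
    (fun y => Γ.val_nonneg (Γ.isB _)) (fun y => Γ.val_le_one (Γ.isB _))
  have hnn : ∀ y : Γ.Y, 0 ≤ Γ.val y.1.1 - Γ.pay y.1.1 y.2 := fun y =>
    sub_nonneg.2 (Γ.pay_le_val (Γ.isB _) _)
  have h0 : ∫ y, (Γ.val y.1.1 - Γ.pay y.1.1 y.2) ∂μ = 0 := by
    refine le_antisymm ?_ (integral_nonneg hnn)
    rw [integral_sub iv ip]; linarith
  rw [integral_eq_zero_iff_of_nonneg hnn (iv.sub ip)] at h0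
  filter_upwards [h3, h0] with y hy hy0
  refine ⟨y.2, fun k hk => Γ.ae_env k y.2 (hy k hk), ?_⟩
  simp only [Pi.zero_apply] at hy0
  linarith

end POMDP

end

section

namespace POMDP
variable (Γ : POMDP)

open Classical in
/-- The belief as an element of the simplex. -/
noncomputable def bS {p : Γ.K → ℝ} (hp : IsBelief p) (σ : Γ.Strategy) (h : Γ.Hist) :
    stdSimplex ℝ Γ.K :=
  if h0 : 0 < Γ.histProb p σ h then ⟨Γ.belief p σ h, Γ.belief_isBelief p σ h h0⟩ else ⟨p, hp⟩

lemma bS_eq {p : Γ.K → ℝ} (hp : IsBelief p) (σ : Γ.Strategy) (h : Γ.Hist)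
    (h0 : 0 < Γ.histProb p σ h) : (Γ.bS hp σ h).1 = Γ.belief p σ h := by
  unfold bS; rw [dif_pos h0]

lemma mul_bS {p : Γ.K → ℝ} (hp : IsBelief p) (σ : Γ.Strategy) (h : Γ.Hist) (F : (Γ.K → ℝ) → ℝ) :
    Γ.histProb p σ h * F (Γ.bS hp σ h).1 = Γ.histProb p σ h * F (Γ.belief p σ h) := by
  rcases (Γ.histProb_nonneg p σ h).eq_or_lt with h0 | h0
  · rw [← h0]; simp
  · rw [Γ.bS_eq hp σ h h0]

/-- Occupation measure. -/
noncomputable def occ {p : Γ.K → ℝ} (hp : IsBelief p) (σ : Γ.Strategy) (N : ℕ) : Measure Γ.Y :=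
  ∑ m ∈ Finset.range N, ∑ h ∈ Γ.Hm m,
    ENNReal.ofReal ((1 / N : ℝ) * Γ.histProb p σ h) • Measure.dirac (Γ.bS hp σ h, Γ.cont σ h)

instance {p : Γ.K → ℝ} (hp : IsBelief p) (σ : Γ.Strategy) (N : ℕ) : IsFiniteMeasure (Γ.occ hp σ N) := by
  refine ⟨?_⟩
  unfold occ
  simp only [Measure.coe_finsetSum, Finset.sum_apply, Measure.smul_apply, measure_univ, smul_eq_mul, mul_one]
  exact ENNReal.sum_lt_top.2 fun m _ => ENNReal.sum_lt_top.2 fun h _ => ENNReal.ofReal_lt_top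

lemma integral_occ {p : Γ.K → ℝ} (hp : IsBelief p) (σ : Γ.Strategy) (N : ℕ) (F : Γ.Y → ℝ) :
    ∫ y, F y ∂(Γ.occ hp σ N) = (1 / N : ℝ) * ∑ m ∈ Finset.range N, ∑ h ∈ Γ.Hm m,
      Γ.histProb p σ h * F (Γ.bS hp σ h, Γ.cont σ h) := by
  have hi : ∀ h, Integrable F (ENNReal.ofReal ((1 / N : ℝ) * Γ.histProb p σ h) •
      Measure.dirac (Γ.bS hp σ h, Γ.cont σ h)) := fun h =>
    (integrable_dirac (by simp)).smul_measure ENNReal.ofReal_ne_top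
  unfold occ
  rw [integral_finsetSum_measure, Finset.mul_sum]
  · refine Finset.sum_congr rfl fun m _ => ?_
    rw [integral_finsetSum_measure, Finset.mul_sum]
    · refine Finset.sum_congr rfl fun h _ => ?_
      rw [integral_smul_measure, integral_dirac, ENNReal.toReal_ofReal, smul_eq_mul, mul_assoc]
      have := Γ.histProb_nonneg p σ h
      positivity
    · intro h _; exact hi h
  · intro m _
    exact integrable_finsetSum_measure.2 fun h _ => hi h

lemma occ_prob {p : Γ.K → ℝ} (hp : IsBelief p) (σ : Γ.Strategy) {N : ℕ} (hN : 0 < N) :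
    IsProbabilityMeasure (Γ.occ hp σ N) := by
  have h := Γ.integral_occ hp σ N (fun _ => 1)
  simp only [integral_const, smul_eq_mul, mul_one, Γ.sum_histProb hp, Finset.sum_const,
    Finset.card_range, nsmul_eq_mul] at h
  have hN' : (N : ℝ) ≠ 0 := by positivity
  rw [one_div_mul_cancel hN', measureReal_def, ENNReal.toReal_eq_one_iff] at h
  exact ⟨h⟩

lemma occ_lin {p : Γ.K → ℝ} (hp : IsBelief p) (σ : Γ.Strategy) (N : ℕ) (F : Γ.K × Γ.Strategy → ℝ) :
    ∫ y, ∑ k, y.1.1 k * F (k, y.2) ∂(Γ.occ hp σ N) = (1 / N : ℝ) * ∑ m ∈ Finset.range N,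
      ∑ h ∈ Γ.Hm m, Γ.histProb p σ h * ∑ k, Γ.belief p σ h k * F (k, Γ.cont σ h) := by
  rw [integral_occ]
  congr 1
  refine Finset.sum_congr rfl fun m _ => Finset.sum_congr rfl fun h _ => ?_
  exact Γ.mul_bS hp σ h (fun b => ∑ k, b k * F (k, Γ.cont σ h))

lemma occ_lin' {p : Γ.K → ℝ} (hp : IsBelief p) (σ : Γ.Strategy) (N : ℕ) {F : Γ.K × Γ.Strategy → ℝ}
    (hF : Measurable F) :
    ∫ y, ∑ k, y.1.1 k * F (k, y.2) ∂(Γ.occ hp σ N) = (1 / N : ℝ) * ∑ m ∈ Finset.range N,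
      ∫ z, F z ∂(Γ.Pk^[m] (Γ.init p σ)) := by
  rw [occ_lin]
  congr 1
  refine Finset.sum_congr rfl fun m _ => ?_
  rw [← Γ.integral_traj' p σ m (fun k h => F (k, Γ.cont σ h)), ← map_state_cont,
    integral_map (Γ.measurable_state_cont σ m).aemeasurable hF.aestronglyMeasurable]

lemma mass_Pk {κ : Measure (Γ.K × Γ.Strategy)} [IsProbabilityMeasure κ] : IsProbabilityMeasure (Γ.Pk κ) :=
  Measure.isProbabilityMeasure_map Γ.measurable_step.aemeasurable

lemma occ_tele {p : Γ.K → ℝ} (hp : IsBelief p) (σ : Γ.Strategy) {N : ℕ} (hN : 0 < N)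
    {F : Γ.K × Γ.Strategy → ℝ} (hF : Continuous F) {C : ℝ} (hC : ∀ z, |F z| ≤ C) :
    |∫ y, ∑ k, y.1.1 k * Γ.Pf F (k, y.2) ∂(Γ.occ hp σ N) -
      ∫ y, ∑ k, y.1.1 k * F (k, y.2) ∂(Γ.occ hp σ N)| ≤ (1 / N : ℝ) * (2 * C) := by
  have hpr : ∀ m, IsProbabilityMeasure (Γ.Pk^[m] (Γ.init p σ)) := by
    intro m
    rw [← map_state_cont]
    have := Γ.envMeasure_prob hp
    exact Measure.isProbabilityMeasure_map (Γ.measurable_state_cont σ m).aemeasurable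
  have hb : ∀ m, |∫ z, F z ∂(Γ.Pk^[m] (Γ.init p σ))| ≤ C := by
    intro m
    have := norm_integral_le_of_norm_le_const (μ := Γ.Pk^[m] (Γ.init p σ)) (f := F) (C := C)
        (ae_of_all _ fun r => hC _)
    simpa using this
  rw [Γ.occ_lin' hp σ N hF.measurable, Γ.occ_lin' hp σ N (Γ.continuous_Pf hF hC).measurable,
    ← mul_sub, ← Finset.sum_sub_distrib, abs_mul, abs_of_nonneg (by positivity)]
  refine mul_le_mul_of_nonneg_left ?_ (by positivity)
  have : ∀ m ∈ Finset.range N, ∫ z, Γ.Pf F z ∂(Γ.Pk^[m] (Γ.init p σ)) - ∫ z, F z ∂(Γ.Pk^[m] (Γ.init p σ)) =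
      ∫ z, F z ∂(Γ.Pk^[m+1] (Γ.init p σ)) - ∫ z, F z ∂(Γ.Pk^[m] (Γ.init p σ)) := by
    intro m _
    rw [Function.iterate_succ_apply', Γ.integral_Pk _ hF.measurable hC]
  rw [Finset.sum_congr rfl this, Finset.sum_range_sub (fun m => ∫ z, F z ∂(Γ.Pk^[m] (Γ.init p σ)))]
  have h1 := abs_le.1 (hb N)
  have h2 := abs_le.1 (hb 0)
  exact abs_le.2 ⟨by linarith, by linarith⟩

lemma occ_val {p : Γ.K → ℝ} (hp : IsBelief p) (σ : Γ.Strategy) {N : ℕ} (hN : 0 < N) :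
    ∫ y, Γ.val y.1.1 ∂(Γ.occ hp σ N) ≤ Γ.val p := by
  rw [integral_occ]
  have : ∀ m ∈ Finset.range N, ∑ h ∈ Γ.Hm m, Γ.histProb p σ h * Γ.val (Γ.bS hp σ h).1 ≤ Γ.val p := by
    intro m _
    simp_rw [Γ.mul_bS hp σ _ Γ.val]
    exact Γ.integral_val_le hp σ m
  have h2 := Finset.sum_le_sum this
  rw [Finset.sum_const, Finset.card_range, nsmul_eq_mul] at h2
  rw [one_div, inv_mul_le_iff₀ (by positivity)]
  exact h2

lemma occ_gf {p : Γ.K → ℝ} (hp : IsBelief p) (σ : Γ.Strategy) (N : ℕ) :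
    ∫ y, ∑ k, y.1.1 k * Γ.gf (k, y.2) ∂(Γ.occ hp σ N) = ∫ ω, Γ.avg σ ω N ∂(Γ.envMeasure p) := by
  rw [occ_lin, integral_gf]

lemma continuous_lin {F : Γ.K × Γ.Strategy → ℝ} (hF : Continuous F) :
    Continuous fun y : Γ.Y => ∑ k, y.1.1 k * F (k, y.2) :=
  continuous_finsetSum _ fun k _ => ((Γ.continuous_co k).comp continuous_fst).mul
    (hF.comp (continuous_const.prodMk continuous_snd))

/-- The limiting argument. -/
lemma exists_limit {p : Γ.K → ℝ} (hp : IsBelief p) :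
    ∃ (σ : ℕ → Γ.Strategy) (N : ℕ → ℕ) (μ : ProbabilityMeasure Γ.Y),
      (∀ n : ℕ, Γ.val p - 1 / (n + 1 : ℝ) < Γ.pay p (σ n)) ∧ (∀ n, 0 < N n) ∧
      (∀ F : Γ.Y → ℝ, Continuous F → Tendsto (fun n => ∫ y, F y ∂(Γ.occ hp (σ n) (N n)))
        (hyperfilter ℕ) (nhds (∫ y, F y ∂(μ : Measure Γ.Y)))) ∧
      (∀ᵐ y ∂(μ : Measure Γ.Y), Γ.Good y.1.1) := by
  have hpos : ∀ n : ℕ, (0:ℝ) < 1 / (n + 1 : ℝ) := fun n => by positivity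
  choose σ hσ using fun n : ℕ => Γ.exists_pay (p := p) (hpos n)
  have hN' : ∀ n : ℕ, ∃ N : ℕ, n + 1 ≤ N ∧
      Γ.pay p (σ n) - 1 / (n + 1 : ℝ) < ∫ ω, Γ.avg (σ n) ω N ∂(Γ.envMeasure p) := fun n =>
    ((eventually_ge_atTop (n + 1)).and (Γ.fatou (p := p) (σ n) (hpos n))).exists
  choose N hNn hN using hN'
  have hN0 : ∀ n, 0 < N n := fun n => by have := hNn n; omega
  let μn : ℕ → ProbabilityMeasure Γ.Y := fun n => ⟨Γ.occ hp (σ n) (N n), Γ.occ_prob hp (σ n) (hN0 n)⟩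
  obtain ⟨μ, -, hμ⟩ := isCompact_univ.ultrafilter_le_nhds ((hyperfilter ℕ).map μn) (by simp)
  have hT : Tendsto μn (hyperfilter ℕ) (nhds μ) := hμ
  have hlim : ∀ F : Γ.Y → ℝ, Continuous F → Tendsto (fun n => ∫ y, F y ∂(Γ.occ hp (σ n) (N n)))
        (hyperfilter ℕ) (nhds (∫ y, F y ∂(μ : Measure Γ.Y))) := fun F hF =>
    (ProbabilityMeasure.tendsto_iff_forall_integral_tendsto.1 hT)
      (BoundedContinuousFunction.mkOfCompact ⟨F, hF⟩)
  have hle : (hyperfilter ℕ : Filter ℕ) ≤ atTop := by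
    rw [← Nat.cofinite_eq_atTop]; exact hyperfilter_le_cofinite
  have hinv0 : Tendsto (fun n : ℕ => 1 / (n + 1 : ℝ)) (hyperfilter ℕ) (nhds 0) :=
    tendsto_one_div_add_atTop_nhds_zero_nat.mono_left hle
  refine ⟨σ, N, μ, hσ, hN0, hlim, ?_⟩
  refine Γ.ae_good (μ : Measure Γ.Y) (v := Γ.val p) ?_ ?_ ?_
  · intro F hF
    obtain ⟨C, hC⟩ : ∃ C, ∀ z, |F z| ≤ C := by
      obtain ⟨C, hC⟩ := isCompact_univ.exists_bound_of_continuousOn hF.continuousOn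
      exact ⟨C, fun z => hC z trivial⟩
    have hC0 : 0 ≤ C := (abs_nonneg _).trans (hC (Classical.arbitrary _))
    have h1 := hlim _ (Γ.continuous_lin (Γ.continuous_Pf hF hC))
    have h2 := hlim _ (Γ.continuous_lin hF)
    have h3 := h1.sub h2
    have h4 : Tendsto (fun n => ∫ y, ∑ k, y.1.1 k * Γ.Pf F (k, y.2) ∂(Γ.occ hp (σ n) (N n)) -
      ∫ y, ∑ k, y.1.1 k * F (k, y.2) ∂(Γ.occ hp (σ n) (N n))) (hyperfilter ℕ) (nhds 0) := by
      have h5 := hinv0.mul_const (2 * C)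
      rw [zero_mul] at h5
      refine squeeze_zero_norm (fun n => ?_) h5
      refine (Γ.occ_tele hp (σ n) (hN0 n) hF hC).trans ?_
      refine mul_le_mul_of_nonneg_right ?_ (by positivity)
      refine one_div_le_one_div_of_le (by positivity) ?_
      exact_mod_cast hNn n
    exact sub_eq_zero.1 (tendsto_nhds_unique h3 h4)
  · have h1 := hlim _ (Γ.continuous_lin Γ.continuous_gf)
    have h2 : Tendsto (fun n : ℕ => Γ.val p - 1 / (n + 1 : ℝ) - 1 / (n + 1 : ℝ)) (hyperfilter ℕ)
        (nhds (Γ.val p)) := by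
      simpa using (hinv0.const_sub (Γ.val p)).sub hinv0
    refine le_of_tendsto_of_tendsto' h2 h1 fun n => ?_
    rw [occ_gf]
    linarith [hσ n, hN n]
  · exact le_of_tendsto' (hlim _ (Γ.continuous_val.comp continuous_fst)) fun n =>
      Γ.occ_val hp (σ n) (hN0 n)

end POMDP

end

/-- **Lemma 1 (Venel–Ziliotto 2016).** For any initial belief `p₁` and `ε > 0` there are a
stage `m₀ ≥ 1`, a strategy `σ^ε` and a belief `p*` (a function of the history before stage
`m₀`) such that: with probability at least `1 - ε` the belief at stage `m₀` is `ε`-close to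
`p*` in `ℓ¹`-norm; from every realization of `p*` there is a strategy `σ` whose average
rewards converge a.s. to `γ^k_∞(σ)` from every `k` in the support of `p*` and which is
`0`-optimal in `Γ(p*)`; and `E[v_∞(p*)] ≥ v_∞(p₁) - ε`. -/
theorem venel_ziliotto (Γ : POMDP) (p1 : Γ.K → ℝ) (hp1 : IsBelief p1)
    (ε : ℝ) (hε : 0 < ε) :
    ∃ m0 ≥ 1, ∃ σε : Γ.Strategy, ∃ pstar : Γ.Hist → Γ.K → ℝ,
      (∀ h, IsBelief (pstar h)) ∧
      (∃ Ω0 : Set Γ.Env,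
        Γ.prob p1 σε Ω0 ≥ 1 - ε ∧
        ∀ ω ∈ Ω0,
          ∑ k, |Γ.belief p1 σε (Γ.hist σε ω (m0 - 1)) k -
              pstar (Γ.hist σε ω (m0 - 1)) k| ≤ ε) ∧
      (∀ h : Γ.Hist, h.length = m0 - 1 → 0 < Γ.histProb p1 σε h →
        ∃ σ : Γ.Strategy,
          (∀ k, 0 < pstar h k →
            ∀ᵐ ω ∂(Γ.envMeasure (diracBelief k)),
              Tendsto (Γ.avg σ ω) atTop (nhds (Γ.payK k σ))) ∧
          Γ.pay (pstar h) σ = Γ.val (pstar h)) ∧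
      (∫ ω, Γ.val (pstar (Γ.hist σε ω (m0 - 1))) ∂(Γ.envMeasure p1) ≥ Γ.val p1 - ε) := by
  classical
  obtain ⟨σ, N, μ, hσ, hN0, hlim, hgood⟩ := Γ.exists_limit hp1
  let G : Set (stdSimplex ℝ Γ.K) := {p | Γ.Good p.1}
  have hGne : G.Nonempty := by
    obtain ⟨y, hy⟩ := hgood.exists
    exact ⟨y.1, hy⟩
  set e := ε / 3 with he
  have he0 : 0 < e := by positivity
  have hK : (0:ℝ) < Γ.nK := by exact_mod_cast Γ.hK
  set δ := e / Γ.nK with hδ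
  have hδ0 : 0 < δ := by positivity
  let φ : stdSimplex ℝ Γ.K → ℝ := fun p => Metric.infDist p G
  have hφ0 : ∀ p, 0 ≤ φ p := fun p => Metric.infDist_nonneg
  have hφc : Continuous φ := Metric.continuous_infDist_pt G
  have hint : ∫ y, φ y.1 ∂(μ : Measure Γ.Y) = 0 := by
    rw [integral_congr_ae (g := fun _ => (0:ℝ))]
    · simp
    · filter_upwards [hgood] with y hy
      exact Metric.infDist_zero_of_mem hy
  have hev1 := hlim (fun y => φ y.1) (hφc.comp continuous_fst)
  rw [hint] at hev1
  have hle : (hyperfilter ℕ : Filter ℕ) ≤ atTop := by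
    rw [← Nat.cofinite_eq_atTop]; exact hyperfilter_le_cofinite
  have hinv0 : Tendsto (fun n : ℕ => 1 / (n + 1 : ℝ)) (hyperfilter ℕ) (nhds 0) :=
    tendsto_one_div_add_atTop_nhds_zero_nat.mono_left hle
  obtain ⟨n, hn1, hn2⟩ := ((hev1.eventually (gt_mem_nhds (show 0 < δ * e by positivity))).and
    (hinv0.eventually (gt_mem_nhds he0))).exists
  have hpay : Γ.val p1 - e < Γ.pay p1 (σ n) := by linarith [hσ n]
  rw [Γ.integral_occ] at hn1
  obtain ⟨m, hm⟩ : ∃ m, ∑ h ∈ Γ.Hm m, Γ.histProb p1 (σ n) h * φ (Γ.bS hp1 (σ n) h) < δ * e := by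
    by_contra hcon
    push Not at hcon
    have h2 := Finset.sum_le_sum fun m (_ : m ∈ Finset.range (N n)) => hcon m
    rw [Finset.sum_const, Finset.card_range, nsmul_eq_mul] at h2
    have hNn : (0:ℝ) < N n := by exact_mod_cast hN0 n
    rw [one_div, inv_mul_lt_iff₀ hNn] at hn1
    linarith
  set s := σ n with hs
  have hP0 : ∀ h, 0 ≤ Γ.histProb p1 s h := Γ.histProb_nonneg p1 s
  have hm' : ∑ h ∈ Γ.Hm m, Γ.histProb p1 s h * (φ (Γ.bS hp1 s h) / δ) ≤ e := by
    have : ∀ h, Γ.histProb p1 s h * (φ (Γ.bS hp1 s h) / δ) =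
      Γ.histProb p1 s h * φ (Γ.bS hp1 s h) / δ := fun h => by ring
    simp_rw [this, ← Finset.sum_div]
    rw [div_le_iff₀ hδ0]; linarith
  have hnear : ∀ p : stdSimplex ℝ Γ.K, ∃ g ∈ G, φ p < δ → ∑ k, |p.1 k - g.1 k| ≤ e := by
    intro p
    by_cases hp : φ p < δ
    · obtain ⟨g, hg, hd⟩ := (Metric.infDist_lt_iff hGne).1 hp
      refine ⟨g, hg, fun _ => ?_⟩
      have : ∀ k ∈ Finset.univ, |p.1 k - g.1 k| ≤ δ := fun k _ => by
        have h1 : dist (p.1 k) (g.1 k) ≤ dist p.1 g.1 := dist_le_pi_dist p.1 g.1 k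
        rw [Real.dist_eq] at h1
        have h2 : dist p.1 g.1 = dist p g := rfl
        linarith
      refine (Finset.sum_le_sum this).trans (le_of_eq ?_)
      simp [hδ]; field_simp
    · obtain ⟨g, hg⟩ := hGne
      exact ⟨g, hg, fun h => absurd h hp⟩
  choose near hnG hnear using hnear
  refine ⟨m + 1, by omega, s, fun h => (near (Γ.bS hp1 s h)).1, fun h => Γ.isB _,
    ⟨{ω | 0 < Γ.histProb p1 s (Γ.hist s ω m) ∧ φ (Γ.bS hp1 s (Γ.hist s ω m)) < δ}, ?_, ?_⟩, ?_, ?_⟩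
  · have hms : MeasurableSet {ω | 0 < Γ.histProb p1 s (Γ.hist s ω m) ∧
        φ (Γ.bS hp1 s (Γ.hist s ω m)) < δ} :=
      Γ.measurableSet_traj_mem s m {x | 0 < Γ.histProb p1 s x.2 ∧ φ (Γ.bS hp1 s x.2) < δ}
    have h1 : Γ.prob p1 s {ω | 0 < Γ.histProb p1 s (Γ.hist s ω m) ∧
        φ (Γ.bS hp1 s (Γ.hist s ω m)) < δ} = ∑ h ∈ Γ.Hm m, Γ.histProb p1 s h *
          (if 0 < Γ.histProb p1 s h ∧ φ (Γ.bS hp1 s h) < δ then 1 else 0) := by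
      rw [← Γ.integral_hist p1 s m (fun h =>
        if 0 < Γ.histProb p1 s h ∧ φ (Γ.bS hp1 s h) < δ then 1 else 0)]
      have := integral_indicator_const (μ := Γ.envMeasure p1) (1:ℝ) hms
      rw [smul_eq_mul, mul_one] at this
      refine this.symm.trans (integral_congr_ae (ae_of_all _ fun ω => ?_))
      simp [Set.indicator]
    rw [h1]
    have h2 : ∑ h ∈ Γ.Hm m, Γ.histProb p1 s h * (1 - φ (Γ.bS hp1 s h) / δ) ≤
        ∑ h ∈ Γ.Hm m, Γ.histProb p1 s h *
          (if 0 < Γ.histProb p1 s h ∧ φ (Γ.bS hp1 s h) < δ then 1 else 0) := by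
      refine Finset.sum_le_sum fun h _ => ?_
      rcases (hP0 h).eq_or_lt with h0 | h0
      · rw [← h0]; simp
      · refine mul_le_mul_of_nonneg_left ?_ h0.le
        split_ifs with hh
        · have : 0 ≤ φ (Γ.bS hp1 s h) / δ := div_nonneg (hφ0 _) hδ0.le
          linarith
        · have : δ ≤ φ (Γ.bS hp1 s h) := by
            by_contra hc; exact hh ⟨h0, not_le.1 hc⟩
          have := (one_le_div hδ0).2 this
          linarith
    simp_rw [mul_sub, Finset.sum_sub_distrib, mul_one] at h2
    rw [Γ.sum_histProb hp1] at h2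
    simp only [mul_ite, mul_one, mul_zero] at h2 ⊢
    linarith
  · rintro ω ⟨h0, hc⟩
    simp only [Nat.add_sub_cancel]
    rw [← Γ.bS_eq hp1 s _ h0]
    exact (hnear _ hc).trans (by linarith)
  · intro h _ _
    exact hnG (Γ.bS hp1 s h)
  · simp only [Nat.add_sub_cancel]
    rw [Γ.integral_hist p1 s m (fun h => Γ.val (near (Γ.bS hp1 s h)).1)]
    have h1 := Γ.pay_le_integral_val p1 s m
    simp_rw [← Γ.mul_bS hp1 s _ Γ.val] at h1
    have h2 : ∑ h ∈ Γ.Hm m, Γ.histProb p1 s h * (Γ.val (Γ.bS hp1 s h).1 - e - φ (Γ.bS hp1 s h) / δ) ≤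
        ∑ h ∈ Γ.Hm m, Γ.histProb p1 s h * Γ.val (near (Γ.bS hp1 s h)).1 := by
      refine Finset.sum_le_sum fun h _ => mul_le_mul_of_nonneg_left ?_ (hP0 h)
      have hnn : 0 ≤ φ (Γ.bS hp1 s h) / δ := div_nonneg (hφ0 _) hδ0.le
      by_cases hc : φ (Γ.bS hp1 s h) < δ
      · have a := hnear _ hc
        have b := Γ.val_lip (Γ.isB (Γ.bS hp1 s h)) (Γ.isB (near (Γ.bS hp1 s h)))
        linarith
      · have a := (one_le_div hδ0).2 (not_lt.1 hc)
        have b := Γ.val_le_one (Γ.isB (Γ.bS hp1 s h))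
        have c := Γ.val_nonneg (Γ.isB (near (Γ.bS hp1 s h)))
        linarith
    simp_rw [mul_sub, Finset.sum_sub_distrib, ← Finset.sum_mul] at h2
    rw [Γ.sum_histProb hp1, one_mul] at h2
    linarith

end PomdpPaper
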